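/- Let G be a finite normal-form game with N ≥ 2 players, and set κ = Σ_n |S_n|, d = N−1, Z = (2d+6)(2d+5)^{κ−1}, D = 5(κ(2d+4)+2)·Z, ℒ = d·(6d−3)^{2κ−1}, ℓ = 2d(ZD)^2(1+Z) and K = ℒ·ℓ. If σ ∈ Σ is a perfect equilibrium of G, then there exists a polynomial strategy-profile η : ℝ → ∏_n ℝ^{S_n} of degree at most K such that η_{n,s_n} > 0 for all n and s_n ∈ S_n, o(η) ≤ ℓ, η(0) = σ, and σ_n is a best reply of order K against η for each player n. -/

import Mathlib

namespace GamePE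

variable {N : ℕ}

/-- A (not necessarily mixed) strategy profile. -/
abbrev Profile (S : Fin N → Type) := ∀ n, S n → ℝ

/-- τ is a profile of mixed strategies. -/
def IsMixed {S : Fin N → Type} [∀ n, Fintype (S n)] (τ : Profile S) : Prop :=
  ∀ n, (∀ s, 0 ≤ τ n s) ∧ (∑ s, τ n s) = 1

/-- τ is completely mixed. -/
def CompletelyMixed {S : Fin N → Type} (τ : Profile S) : Prop := ∀ n s, 0 < τ n s

/-- The pure strategy sn viewed as a mixed strategy. -/
def pureStrat {S : Fin N → Type} [∀ n, DecidableEq (S n)] {n : Fin N} (sn : S n) : S n → ℝ :=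
  fun s => if s = sn then 1 else 0

/-- The multilinear extension of player n's payoff. -/
noncomputable def payoff {S : Fin N → Type} [∀ n, Fintype (S n)]
    (G : Fin N → (∀ m, S m) → ℝ) (n : Fin N) (τ : Profile S) : ℝ :=
  ∑ s : ∀ m, S m, (∏ m, τ m (s m)) * G n s

/-- σ is a perfect equilibrium of the game G. -/
noncomputable def IsPerfect {S : Fin N → Type} [∀ n, Fintype (S n)] [∀ n, DecidableEq (S n)]
    (G : Fin N → (∀ m, S m) → ℝ) (σ : Profile S) : Prop :=
  ∃ σk : ℕ → Profile S,
    (∀ k, IsMixed (σk k) ∧ CompletelyMixed (σk k)) ∧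
    Filter.Tendsto σk Filter.atTop (nhds σ) ∧
    (∀ (k : ℕ) (n : Fin N) (sn : S n),
      payoff G n (Function.update (σk k) n (σ n)) ≥
        payoff G n (Function.update (σk k) n (pureStrat sn)))

/-- ϱ is an LPS profile of order K : each level of each player is a probability distribution. -/
def IsLPSProfile {S : Fin N → Type} [∀ n, Fintype (S n)] {K : ℕ}
    (ϱ : ∀ n, Fin (K+1) → S n → ℝ) : Prop :=
  ∀ n k, (∀ s, 0 ≤ ϱ n k s) ∧ (∑ s, ϱ n k s) = 1

/-- Full support for an LPS profile. -/
def FullSupport {S : Fin N → Type} {K : ℕ} (ϱ : ∀ n, Fin (K+1) → S n → ℝ) : Prop :=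
  ∀ n, ∀ s : S n, ∃ k, ϱ n k s ≠ 0

/-- ℓ(ϱ) : the max over the players of the first level at which the union of supports is everything. -/
noncomputable def lpsLevel {S : Fin N → Type} [∀ n, Fintype (S n)] {K : ℕ}
    (ϱ : ∀ n, Fin (K+1) → S n → ℝ) : ℕ :=
  Finset.univ.sup fun n =>
    sInf {k : ℕ | ∀ s : S n, ∃ i : Fin (K+1), (i : ℕ) ≤ k ∧ ϱ n i s ≠ 0}

/-- Combine a pure strategy of player n with a pure strategy profile of the others. -/
def combine {S : Fin N → Type} (n : Fin N) (sn : S n)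
    (so : ∀ m : {m : Fin N // m ≠ n}, S m.val) : ∀ m, S m :=
  fun m => if h : m = n then cast (congrArg S h.symm) sn else so ⟨m, h⟩

/-- Unnormalized induced beliefs of player n at level k. -/
noncomputable def ubelief {S : Fin N → Type} [∀ n, Fintype (S n)] {K : ℕ}
    (ϱ : ∀ n, Fin (K+1) → S n → ℝ) (n : Fin N) (k : ℕ)
    (so : ∀ m : {m : Fin N // m ≠ n}, S m.val) : ℝ :=
  ∑ kv ∈ Finset.univ.filter
      (fun kv : {m : Fin N // m ≠ n} → Fin (K+1) => (∑ m, ((kv m : ℕ))) = k),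
    ∏ m : {m : Fin N // m ≠ n}, ϱ m.val (kv m) (so m)

/-- Induced beliefs μ_n^k of player n at level k (normalized). -/
noncomputable def belief {S : Fin N → Type} [∀ n, Fintype (S n)] {K : ℕ}
    (ϱ : ∀ n, Fin (K+1) → S n → ℝ) (n : Fin N) (k : ℕ)
    (so : ∀ m : {m : Fin N // m ≠ n}, S m.val) : ℝ :=
  (∑ so' : ∀ m : {m : Fin N // m ≠ n}, S m.val, ubelief ϱ n k so')⁻¹ * ubelief ϱ n k so

/-- Expected payoff of player n playing τn against a belief μ over the opponents' profiles. -/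
noncomputable def beliefPayoff {S : Fin N → Type} [∀ n, Fintype (S n)]
    (G : Fin N → (∀ m, S m) → ℝ) (n : Fin N) (τn : S n → ℝ)
    (μ : (∀ m : {m : Fin N // m ≠ n}, S m.val) → ℝ) : ℝ :=
  ∑ so : ∀ m : {m : Fin N // m ≠ n}, S m.val, ∑ sn : S n,
    μ so * τn sn * G n (combine n sn so)

/-- Lexicographic comparison of the first k+1 entries (indices 0,…,k) of two sequences. -/
def lexGe (k : ℕ) (a b : ℕ → ℝ) : Prop :=
  (∀ i ≤ k, a i = b i) ∨ ∃ i ≤ k, (∀ j < i, a j = b j) ∧ b i < a i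

/-- τn is a best reply of order k against the LPS profile ϱ. -/
noncomputable def lpsBestReply {S : Fin N → Type} [∀ n, Fintype (S n)] [∀ n, DecidableEq (S n)]
    (G : Fin N → (∀ m, S m) → ℝ) {K : ℕ} (ϱ : ∀ n, Fin (K+1) → S n → ℝ)
    (n : Fin N) (τn : S n → ℝ) (k : ℕ) : Prop :=
  ∀ sn : S n,
    lexGe k (fun i => beliefPayoff G n τn (belief ϱ n i))
            (fun i => beliefPayoff G n (pureStrat sn) (belief ϱ n i))

/-- A polynomial strategy profile. -/
abbrev PolyProfile (S : Fin N → Type) := ∀ n, S n → Polynomial ℝ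

/-- f > 0 for a univariate real polynomial: the trailing (lowest-order) coefficient is positive. -/
def polyPos (f : Polynomial ℝ) : Prop := 0 < f.trailingCoeff

/-- f ≥ 0 : f is identically zero or its trailing coefficient is positive. -/
def polyNonneg (f : Polynomial ℝ) : Prop := f = 0 ∨ 0 < f.trailingCoeff

/-- The order o(η) of a polynomial strategy profile (∞ if some coordinate is zero). -/
noncomputable def polyOrder {S : Fin N → Type} [∀ n, Fintype (S n)]
    (η : PolyProfile S) : ℕ∞ :=
  Finset.univ.sup fun p : Σ n, S n => (η p.1 p.2).trailingDegree

/-- The polynomial t ↦ G_n(τn, η_{-n}(t)). -/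
noncomputable def payoffPoly {S : Fin N → Type} [∀ n, Fintype (S n)]
    (G : Fin N → (∀ m, S m) → ℝ) (η : PolyProfile S) (n : Fin N) (τn : S n → ℝ) :
    Polynomial ℝ :=
  ∑ s : ∀ m, S m,
    (Polynomial.C (τn (s n)) * ∏ m ∈ Finset.univ.erase n, η m (s m)) * Polynomial.C (G n s)

/-- τn is a best reply of order r against the polynomial strategy profile η. -/
noncomputable def polyBestReply {S : Fin N → Type} [∀ n, Fintype (S n)] [∀ n, DecidableEq (S n)]
    (G : Fin N → (∀ m, S m) → ℝ) (η : PolyProfile S) (n : Fin N) (τn : S n → ℝ) (r : ℕ) : Prop :=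
  ∀ sn : S n,
    polyNonneg (payoffPoly G η n τn - payoffPoly G η n (pureStrat sn)) ∨
    ((r + 1 : ℕ) : ℕ∞) ≤ (payoffPoly G η n τn - payoffPoly G η n (pureStrat sn)).trailingDegree
/-- Stars and bars: the number of monomials of total degree at most `m`. -/
theorem card_sum_le_eq_choose {V : Type*} [Fintype V] (m : ℕ) :
    Nat.card {b : V →₀ ℕ | (b.sum fun _ e => e) ≤ m} =
      (Fintype.card V + m).choose (Fintype.card V) := by
  classical
  have hsum : ∀ f : Option V →₀ ℕ, (∑ i, f i) = f none + (f.some.sum fun _ e => e) := by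
    intro f
    rw [Fintype.sum_option, Finsupp.sum_fintype _ _ (fun _ => rfl)]
    rfl
  have hcard : Nat.card ((Finset.univ : Finset (Option V)).finsuppAntidiag m) =
      (Fintype.card V + m).choose (Fintype.card V) := by
    rw [Nat.card_eq_fintype_card, Fintype.card_coe, Finset.card_finsuppAntidiag_nat_eq_choose,
      Finset.card_univ, Fintype.card_option, Nat.add_right_comm, Nat.add_sub_cancel,
      Nat.choose_symm_add]
  rw [← hcard]
  have hle : ∀ f : (Finset.univ : Finset (Option V)).finsuppAntidiag m,
      (f.1.some.sum fun _ e => e) ≤ m := by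
    intro f
    have h := (Finset.mem_finsuppAntidiag.1 f.2).1
    rw [hsum] at h
    exact le_of_le_of_eq (Nat.le_add_left _ _) h
  refine (Nat.card_congr (Equiv.ofBijective (fun f => ⟨f.1.some, hle f⟩) ⟨?_, ?_⟩)).symm
  · rintro ⟨f, hf⟩ ⟨g, hg⟩ hfg
    have h : f.some = g.some := congrArg Subtype.val hfg
    have h1 := (Finset.mem_finsuppAntidiag.1 hf).1
    have h2 := (Finset.mem_finsuppAntidiag.1 hg).1
    rw [hsum] at h1 h2
    rw [h] at h1
    apply Subtype.ext
    ext o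
    cases o with
    | none => show f none = g none; omega
    | some v => exact DFunLike.congr_fun h v
  · rintro ⟨b, hb⟩
    have hb' : (b.sum fun _ e => e) ≤ m := hb
    have hs : (Finsupp.optionElim (m - b.sum fun _ e => e) b).some = b := by
      ext v; simp
    refine ⟨⟨Finsupp.optionElim (m - b.sum fun _ e => e) b, ?_⟩, Subtype.ext hs⟩
    rw [Finset.mem_finsuppAntidiag]
    refine ⟨?_, Finset.subset_univ _⟩
    rw [hsum, hs]
    simp only [Finsupp.optionElim_apply_none]
    omega

theorem eventually_choose_lt_mul_choose (n D A : ℕ) {r : ℕ} (hr : D ^ n < r) :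
    ∀ᶠ m : ℕ in Filter.atTop, (n + (A + D * m)).choose n < r * (n + m).choose n := by
  have hlim : Filter.Tendsto (fun m : ℕ => ((n + A : ℕ) / (m : ℝ) + D) ^ n) Filter.atTop
      (nhds (((0 : ℝ) + D) ^ n)) :=
    ((tendsto_const_div_atTop_nhds_zero_nat _).add tendsto_const_nhds).pow n
  have hlt : ((0 : ℝ) + D) ^ n < r := by rw [zero_add]; exact_mod_cast hr
  filter_upwards [hlim.eventually (gt_mem_nhds hlt), Filter.eventually_gt_atTop 0] with m hm hm0
  have hm0' : (0 : ℝ) < m := by exact_mod_cast hm0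
  have hup := Nat.choose_le_pow_div (α := ℝ) n (n + (A + D * m))
  have hlow := Nat.pow_le_choose (α := ℝ) n (n + m)
  have hf : (0 : ℝ) < n.factorial := by exact_mod_cast n.factorial_pos
  have hkey : ((n + (A + D * m) : ℕ) : ℝ) ^ n < r * (m : ℝ) ^ n := by
    have : ((n + (A + D * m) : ℕ) : ℝ) = ((n + A : ℕ) / (m : ℝ) + D) * m := by
      push_cast; field_simp; ring
    rw [this, mul_pow]
    exact mul_lt_mul_of_pos_right hm (by positivity)
  have hlow' : (m : ℝ) ^ n / n.factorial ≤ ((n + m).choose n : ℝ) := by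
    refine le_trans ?_ hlow
    gcongr
    omega
  have : (((n + (A + D * m)).choose n : ℕ) : ℝ) < r * ((n + m).choose n : ℕ) := by
    calc _ ≤ ((n + (A + D * m) : ℕ) : ℝ) ^ n / n.factorial := by exact_mod_cast hup
      _ < (r * (m : ℝ) ^ n) / n.factorial := by gcongr
      _ = r * ((m : ℝ) ^ n / n.factorial) := by ring
      _ ≤ _ := by gcongr
  exact_mod_cast this

/-- More than `D ^ |V|` polynomials in the variables `V` are linearly dependent over the subring
generated by `|V|` polynomials of degree at most `D`. -/
theorem exists_relation_of_pow_card_lt {V : Type*} [Fintype V] {D r : ℕ}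
    (f : V → MvPolynomial V ℝ) (hf : ∀ v, (f v).totalDegree ≤ D)
    (g : Fin r → MvPolynomial V ℝ) (hr : D ^ Fintype.card V < r) :
    ∃ P : Fin r → MvPolynomial V ℝ, P ≠ 0 ∧
      ∑ a, g a * MvPolynomial.aeval f (P a) = 0 := by
  classical
  set A := Finset.univ.sup fun a => (g a).totalDegree with hA
  obtain ⟨m, hm⟩ := (eventually_choose_lt_mul_choose (Fintype.card V) D A hr).exists
  set S : Set (V →₀ ℕ) := {b : V →₀ ℕ | (b.sum fun _ e => e) ≤ m} with hS
  have hSfin : Finite S := by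
    apply Nat.finite_of_card_ne_zero
    rw [hS, card_sum_le_eq_choose]
    exact (Nat.choose_pos (Nat.le_add_right _ _)).ne'
  have : Fintype S := Fintype.ofFinite S
  have hfr : Module.finrank ℝ (MvPolynomial.restrictTotalDegree V ℝ (A + D * m)) =
      (Fintype.card V + (A + D * m)).choose (Fintype.card V) := by
    rw [← card_sum_le_eq_choose]
    exact Module.finrank_eq_nat_card_basis (MvPolynomial.basisRestrictSupport ℝ _)
  have hmem : ∀ p : Fin r × S, g p.1 * MvPolynomial.aeval f (MvPolynomial.monomial p.2.1 (1 : ℝ)) ∈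
      MvPolynomial.restrictTotalDegree V ℝ (A + D * m) := by
    rintro ⟨a, b, hb⟩
    rw [MvPolynomial.mem_restrictTotalDegree]
    refine (MvPolynomial.totalDegree_mul _ _).trans (add_le_add ?_ ?_)
    · exact Finset.le_sup (f := fun a => (g a).totalDegree) (Finset.mem_univ a)
    · rw [MvPolynomial.aeval_monomial, map_one, one_mul, Finsupp.prod]
      refine (MvPolynomial.totalDegree_finsetProd _ _).trans ?_
      calc ∑ i ∈ b.support, (f i ^ b i).totalDegree ≤ ∑ i ∈ b.support, D * b i := by
            refine Finset.sum_le_sum fun i _ => (MvPolynomial.totalDegree_pow _ _).trans ?_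
            rw [mul_comm]
            exact Nat.mul_le_mul_right _ (hf i)
        _ = D * b.sum fun _ e => e := by rw [Finsupp.sum, Finset.mul_sum]
        _ ≤ D * m := Nat.mul_le_mul_left _ hb
  have hnot : ¬ LinearIndependent ℝ (fun p : Fin r × S =>
      (⟨_, hmem p⟩ : MvPolynomial.restrictTotalDegree V ℝ (A + D * m))) := by
    intro h
    have h1 := h.fintype_card_le_finrank
    rw [hfr, Fintype.card_prod, Fintype.card_fin, ← Nat.card_eq_fintype_card (α := S),
      card_sum_le_eq_choose] at h1
    omega
  obtain ⟨c, hc, ⟨a₀, b₀⟩, hne⟩ := Fintype.not_linearIndependent_iff.1 hnot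
  refine ⟨fun a => ∑ b : S, MvPolynomial.monomial b.1 (c (a, b)), ?_, ?_⟩
  · intro h
    apply hne
    have h1 := congrArg (MvPolynomial.coeff b₀.1) (congrFun h a₀)
    simpa [MvPolynomial.coeff_sum, MvPolynomial.coeff_monomial, Subtype.coe_inj] using h1
  · have h1 := congrArg Subtype.val hc
    rw [Submodule.coe_sum, Fintype.sum_prod_type] at h1
    simp only [Submodule.coe_smul, ZeroMemClass.coe_zero] at h1
    rw [← h1]
    refine Finset.sum_congr rfl fun a _ => ?_
    rw [map_sum, Finset.mul_sum]
    refine Finset.sum_congr rfl fun b _ => ?_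
    rw [← mul_smul_comm, ← map_smul, MvPolynomial.smul_monomial, smul_eq_mul, mul_one]

open Filter Topology in
/-- There is an ultrafilter of parameters `(η, c)` with `|c| ≪ η ≪ 1` which avoids the zero set of
every nonzero polynomial. -/
theorem exists_generic_ultrafilter (Y : Type*) :
    ∃ U : Ultrafilter (Option Y → ℝ),
      (∀ P : MvPolynomial (Option (Option Y)) ℝ, P ≠ 0 →
        ∀ᶠ θ in (U : Filter (Option Y → ℝ)), ∃ ε : ℝ, MvPolynomial.eval (Option.elim · ε θ) P ≠ 0) ∧
      (∀ δ : ℝ, 0 < δ → ∀ᶠ θ in (U : Filter (Option Y → ℝ)),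
        0 < θ none ∧ θ none < δ ∧ ∀ v, |θ (some v)| < δ * θ none) := by
  classical
  let A : {P : MvPolynomial (Option (Option Y)) ℝ // P ≠ 0} × {δ : ℝ // 0 < δ} →
      Set (Option Y → ℝ) := fun p => {θ | (∃ ε : ℝ, MvPolynomial.eval (Option.elim · ε θ) p.1.1 ≠ 0) ∧
        0 < θ none ∧ θ none < p.2.1 ∧ ∀ v, |θ (some v)| < p.2.1 * θ none}
  have hdir : Directed (· ≥ ·) fun p => 𝓟 (A p) := by
    rintro ⟨⟨P, hP⟩, δ, hδ⟩ ⟨⟨Q, hQ⟩, δ', hδ'⟩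
    refine ⟨⟨⟨P * Q, mul_ne_zero hP hQ⟩, min δ δ', lt_min hδ hδ'⟩, ?_, ?_⟩ <;>
    · simp only [ge_iff_le, le_principal_iff, mem_principal]
      rintro θ ⟨⟨ε, hε⟩, h1, h2, h3⟩
      rw [map_mul] at hε
      refine ⟨⟨ε, ?_⟩, h1, ?_, fun v => (h3 v).trans_le ?_⟩
      · first | exact left_ne_zero_of_mul hε | exact right_ne_zero_of_mul hε
      · exact h2.trans_le (by simp)
      · exact mul_le_mul_of_nonneg_right (by simp) h1.le
  have hne : ∀ p, (𝓟 (A p)).NeBot := by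
    rintro ⟨⟨P, hP⟩, δ, hδ⟩
    rw [principal_neBot_iff]
    by_contra hemp
    apply hP
    let s : Option (Option Y) → Set ℝ := fun o =>
      o.elim Set.univ fun o => o.elim (Set.Ioo (δ / 2) δ) fun _ => Set.Ioo (-(δ ^ 2 / 2)) (δ ^ 2 / 2)
    have hδ2 : 0 < δ ^ 2 := by positivity
    refine MvPolynomial.funext_set s ?_ ?_
    · rintro (_ | _ | v)
      · exact Set.infinite_univ
      · exact Set.Ioo_infinite (by linarith)
      · exact Set.Ioo_infinite (by linarith)
    · intro x hx
      rw [map_zero]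
      by_contra hxP
      apply hemp
      have h0 : x (some none) ∈ Set.Ioo (δ / 2) δ := hx (some none) trivial
      refine ⟨fun o => x (some o), ⟨x none, ?_⟩, by linarith [h0.1], h0.2, fun v => ?_⟩
      · have hx' : (fun o => Option.elim o (x none) fun o => x (some o)) = x := by
          funext o
          cases o <;> rfl
        rwa [hx']
      · have h1 : x (some (some v)) ∈ Set.Ioo (-(δ ^ 2 / 2)) (δ ^ 2 / 2) := hx (some (some v)) trivial
        have h2 : |x (some (some v))| < δ ^ 2 / 2 := abs_lt.2 h1
        show |x (some (some v))| < δ * x (some none)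
        nlinarith [h0.1]
  have : Nonempty ({P : MvPolynomial (Option (Option Y)) ℝ // P ≠ 0} × {δ : ℝ // 0 < δ}) :=
    ⟨⟨⟨1, one_ne_zero⟩, 1, one_pos⟩⟩
  have : NeBot (⨅ p, 𝓟 (A p)) := iInf_neBot_of_directed hdir hne
  have hU : ∀ p, A p ∈ (Ultrafilter.of (⨅ p, 𝓟 (A p)) : Filter (Option Y → ℝ)) := fun p =>
    Ultrafilter.of_le _ (mem_iInf_of_mem p (mem_principal_self _))
  refine ⟨Ultrafilter.of (⨅ p, 𝓟 (A p)), fun P hP => ?_, fun δ hδ => ?_⟩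
  · filter_upwards [hU ⟨⟨P, hP⟩, 1, one_pos⟩] with θ hθ using hθ.1
  · filter_upwards [hU ⟨⟨1, one_ne_zero⟩, δ, hδ⟩] with θ hθ using hθ.2

open Filter Topology in
/-- Specialization of a nonzero tuple of polynomials along a generic ultrafilter, after rescaling,
has a nonzero limit. -/
theorem exists_rescaled_specialization {W : Type*} {r : ℕ} (U : Ultrafilter (W → ℝ))
    (hU : ∀ P : MvPolynomial (Option W) ℝ, P ≠ 0 →
      ∀ᶠ θ in (U : Filter (W → ℝ)), ∃ ε : ℝ, MvPolynomial.eval (Option.elim · ε θ) P ≠ 0)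
    (P : Fin r → MvPolynomial (Option W) ℝ) (hP : P ≠ 0) :
    ∃ Q : Fin r → Polynomial ℝ, Q ≠ 0 ∧ ∃ s : (W → ℝ) → ℝ, ∀ a ε,
      Tendsto (fun θ => s θ * MvPolynomial.eval (Option.elim · ε θ) (P a)) (U : Filter (W → ℝ))
        (𝓝 ((Q a).eval ε)) := by
  classical
  let sp : (W → ℝ) → Fin r → Polynomial ℝ := fun θ a =>
    MvPolynomial.aeval (fun o : Option W => o.elim Polynomial.X fun w => Polynomial.C (θ w)) (P a)
  have hsp : ∀ θ a ε, (sp θ a).eval ε = MvPolynomial.eval (Option.elim · ε θ) (P a) := by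
    intro θ a ε
    have h : (Polynomial.aeval ε).comp (MvPolynomial.aeval (R := ℝ)
        (fun o : Option W => o.elim Polynomial.X fun w => Polynomial.C (θ w))) =
        MvPolynomial.aeval (Option.elim · ε θ) := by
      apply MvPolynomial.algHom_ext
      rintro (_ | w) <;> simp
    have := DFunLike.congr_fun h (P a)
    simpa [sp, Polynomial.coe_aeval_eq_eval, MvPolynomial.aeval_eq_eval] using this
  set M := Finset.univ.sup fun a => (P a).totalDegree with hM
  have hdeg : ∀ θ a, (sp θ a).natDegree < M + 1 := by
    intro θ a
    have h1 : (P a).totalDegree ≤ M :=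
      Finset.le_sup (f := fun a => (P a).totalDegree) (Finset.mem_univ a)
    have := MvPolynomial.aeval_natDegree_le (P a) h1
      (fun o : Option W => o.elim Polynomial.X fun w => Polynomial.C (θ w)) (n := 1) (by
        rintro (_ | w) <;> simp)
    simp only [sp]
    omega
  let w : (W → ℝ) → Fin r × Fin (M + 1) → ℝ := fun θ p => (sp θ p.1).coeff p.2
  have hw : ∀ᶠ θ in (U : Filter (W → ℝ)), w θ ≠ 0 := by
    obtain ⟨a, ha⟩ := Function.ne_iff.1 hP
    filter_upwards [hU (P a) ha] with θ hθ hw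
    obtain ⟨ε, hε⟩ := hθ
    apply hε
    rw [← hsp, Polynomial.eval_eq_sum_range' (hdeg θ a)]
    refine Finset.sum_eq_zero fun i hi => ?_
    have := congrFun hw (a, ⟨i, Finset.mem_range.1 hi⟩)
    simp only [w, Pi.zero_apply] at this
    rw [this, zero_mul]
  have hsph : ∀ᶠ θ in (U : Filter (W → ℝ)), ‖w θ‖⁻¹ • w θ ∈
      Metric.sphere (0 : Fin r × Fin (M + 1) → ℝ) 1 := by
    filter_upwards [hw] with θ hθ
    rw [mem_sphere_zero_iff_norm, norm_smul, norm_inv, norm_norm,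
      inv_mul_cancel₀ (norm_ne_zero_iff.2 hθ)]
  obtain ⟨q, hq, hlim⟩ := (isCompact_sphere (0 : Fin r × Fin (M + 1) → ℝ) 1).ultrafilter_le_nhds
    (U.map fun θ => ‖w θ‖⁻¹ • w θ) (le_principal_iff.2 hsph)
  have hlim' : Tendsto (fun θ => ‖w θ‖⁻¹ • w θ) (U : Filter (W → ℝ)) (𝓝 q) := hlim
  refine ⟨fun a => ∑ i : Fin (M + 1), Polynomial.monomial i (q (a, i)), ?_,
    fun θ => ‖w θ‖⁻¹, fun a ε => ?_⟩
  · intro h0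
    have hq0 : q ≠ 0 := ne_zero_of_mem_unit_sphere (⟨q, hq⟩ : Metric.sphere _ 1)
    apply hq0
    funext ⟨a, i⟩
    have := congrArg (fun p => Polynomial.coeff p i) (congrFun h0 a)
    simpa [Polynomial.finsetSum_coeff, Polynomial.coeff_monomial, Fin.val_inj] using this
  · have h1 : ∀ θ, ‖w θ‖⁻¹ * MvPolynomial.eval (Option.elim · ε θ) (P a) =
        ∑ i : Fin (M + 1), (‖w θ‖⁻¹ • w θ) (a, i) * ε ^ (i : ℕ) := by
      intro θ
      rw [← hsp, Polynomial.eval_eq_sum_range' (hdeg θ a), ← Fin.sum_univ_eq_sum_range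
        (fun i => (sp θ a).coeff i * ε ^ i), Finset.mul_sum]
      refine Finset.sum_congr rfl fun i _ => ?_
      simp only [w, Pi.smul_apply, smul_eq_mul]
      ring
    simp_rw [h1]
    rw [Polynomial.eval_finsetSum]
    simp_rw [Polynomial.eval_monomial]
    exact tendsto_finsetSum _ fun i _ => (((continuous_apply (a, i)).tendsto _).comp hlim').mul_const _

open Filter Topology in
/-- Limits, along a generic ultrafilter, of solutions of `f = c` satisfy algebraic relations of
bounded degree. -/
theorem exists_relation_of_generic_limit {Y : Type*} [Fintype Y] {r D : ℕ}
    (U : Ultrafilter (Option Y → ℝ))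
    (hU : ∀ P : MvPolynomial (Option (Option Y)) ℝ, P ≠ 0 →
      ∀ᶠ θ in (U : Filter (Option Y → ℝ)), ∃ ε : ℝ, MvPolynomial.eval (Option.elim · ε θ) P ≠ 0)
    (hU0 : Tendsto (fun θ : Option Y → ℝ => θ none) (U : Filter (Option Y → ℝ)) (𝓝 0))
    (hD : 1 ≤ D) (f : Y → MvPolynomial (Option (Option Y)) ℝ) (hf : ∀ v, (f v).totalDegree ≤ D)
    (g : Fin r → MvPolynomial (Option (Option Y)) ℝ) (hr : D ^ (Fintype.card Y + 2) < r) :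
    ∃ Q : Fin r → Polynomial ℝ, Q ≠ 0 ∧ ∀ (ε : ℝ) (y₀ : Y → ℝ) (y : (Option Y → ℝ) → Y → ℝ),
      Tendsto y (U : Filter (Option Y → ℝ)) (𝓝 y₀) →
      (∀ᶠ θ in (U : Filter (Option Y → ℝ)), ∀ v,
        MvPolynomial.eval (Option.elim · ε (Option.elim · (θ none) (y θ))) (f v) = θ (some v)) →
      ∑ a, MvPolynomial.eval (Option.elim · ε (Option.elim · 0 y₀)) (g a) * (Q a).eval ε = 0 := by
  let F : Option (Option Y) → MvPolynomial (Option (Option Y)) ℝ := fun o =>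
    o.elim (MvPolynomial.X none) fun o => o.elim (MvPolynomial.X (some none)) f
  have hF : ∀ o, (F o).totalDegree ≤ D := by
    rintro (_ | _ | v)
    · simpa [F] using hD
    · simpa [F] using hD
    · exact hf v
  obtain ⟨P, hP, hrel⟩ := exists_relation_of_pow_card_lt F hF g (by simpa using hr)
  obtain ⟨Q, hQ, s, hs⟩ := exists_rescaled_specialization U hU P hP
  refine ⟨Q, hQ, fun ε y₀ y hy hcrit => ?_⟩
  have hpt : Tendsto (fun θ => (fun o => Option.elim o ε (Option.elim · (θ none) (y θ)) :
      Option (Option Y) → ℝ)) (U : Filter (Option Y → ℝ))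
      (𝓝 (Option.elim · ε (Option.elim · 0 y₀))) := by
    rw [tendsto_pi_nhds]
    rintro (_ | _ | v)
    · exact tendsto_const_nhds
    · exact hU0
    · exact (tendsto_pi_nhds.1 hy) v
  have hlim : Tendsto (fun θ => ∑ a,
      MvPolynomial.eval (Option.elim · ε (Option.elim · (θ none) (y θ))) (g a) *
        (s θ * MvPolynomial.eval (Option.elim · ε θ) (P a))) (U : Filter (Option Y → ℝ))
      (𝓝 (∑ a, MvPolynomial.eval (Option.elim · ε (Option.elim · 0 y₀)) (g a) * (Q a).eval ε)) :=
    tendsto_finsetSum _ fun a _ =>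
      (((MvPolynomial.continuous_eval (g a)).tendsto _).comp hpt).mul (hs a ε)
  refine tendsto_nhds_unique (hlim.congr' ?_) tendsto_const_nhds
  filter_upwards [hcrit] with θ hθ
  have h1 := congrArg (MvPolynomial.eval (Option.elim · ε (Option.elim · (θ none) (y θ)))) hrel
  rw [map_zero, map_sum] at h1
  have h2 : ∀ a, MvPolynomial.eval (Option.elim · ε (Option.elim · (θ none) (y θ)))
      (MvPolynomial.aeval F (P a)) = MvPolynomial.eval (Option.elim · ε θ) (P a) := by
    intro a
    have hpt' : (fun o => MvPolynomial.eval (Option.elim · ε (Option.elim · (θ none) (y θ))) (F o)) =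
        (Option.elim · ε θ) := by
      funext o
      rcases o with (_ | _ | v)
      · simp [F]
      · simp [F]
      · exact hθ v
    rw [MvPolynomial.aeval_eq_bind₁, ← MvPolynomial.coe_aeval_eq_eval,
      RingHom.coe_coe, MvPolynomial.aeval_bind₁, MvPolynomial.aeval_eq_eval]
    simp_rw [MvPolynomial.aeval_eq_eval]
    exact congrArg (fun z => MvPolynomial.eval z (P a)) hpt'
  simp_rw [map_mul, h2] at h1
  calc _ = s θ * ∑ a, MvPolynomial.eval (Option.elim · ε (Option.elim · (θ none) (y θ))) (g a) *
        MvPolynomial.eval (Option.elim · ε θ) (P a) := by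
        rw [Finset.mul_sum]
        exact Finset.sum_congr rfl fun a _ => by ring
    _ = 0 := by rw [h1, mul_zero]

open Filter Topology in
/-- Quadratic penalization: minimizers of generic linear perturbations of the penalized distance
converge to feasible points that are at least as close to `σ` as a given feasible point. -/
theorem exists_limit_penalized_minimizers {ι J : Type*} [Fintype ι] [Fintype J]
    (U : Ultrafilter (Option (ι ⊕ J) → ℝ))
    (hU : ∀ δ : ℝ, 0 < δ → ∀ᶠ θ in (U : Filter (Option (ι ⊕ J) → ℝ)),
        0 < θ none ∧ θ none < δ ∧ ∀ v, |θ (some v)| < δ * θ none)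
    (q : J → (ι → ℝ) → ℝ) (hq : ∀ j, Continuous (q j)) (σ a : ι → ℝ)
    (ha : ∀ j, 0 ≤ q j a) (haσ : ∑ i, (a i - σ i) ^ 2 < 1) :
    ∃ (y₀ : ι ⊕ J → ℝ) (y : (Option (ι ⊕ J) → ℝ) → ι ⊕ J → ℝ),
      Tendsto y (U : Filter (Option (ι ⊕ J) → ℝ)) (𝓝 y₀) ∧
      ∑ i, (y₀ (.inl i) - σ i) ^ 2 ≤ ∑ i, (a i - σ i) ^ 2 ∧
      (∀ j, q j (fun i => y₀ (.inl i)) = y₀ (.inr j) ^ 2) ∧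
      ∀ᶠ θ in (U : Filter (Option (ι ⊕ J) → ℝ)), IsLocalMin (fun z : ι ⊕ J → ℝ =>
        (θ none * ∑ i, (z (.inl i) - σ i) ^ 2 +
          1 / 2 * ∑ j, (q j (fun i => z (.inl i)) - z (.inr j) ^ 2) ^ 2) -
            ∑ v, θ (some v) * z v) (y θ) := by
  classical
  have hcoord : ∀ (x : ι → ℝ), ∑ i, (x i - σ i) ^ 2 < 1 → ∀ i, |x i - σ i| < 1 := by
    intro x hx i
    rw [← sq_lt_one_iff_abs_lt_one]
    exact (Finset.single_le_sum (f := fun i => (x i - σ i) ^ 2) (fun _ _ => sq_nonneg _)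
      (Finset.mem_univ i)).trans_lt hx
  obtain ⟨M, hM⟩ : ∃ M, ∀ j, ∀ x ∈ Set.Icc (fun i => σ i - 1) (fun i => σ i + 1), q j x ≤ M := by
    have h : ∀ j, ∃ M, ∀ x ∈ Set.Icc (fun i => σ i - 1) (fun i => σ i + 1), q j x ≤ M := fun j => by
      obtain ⟨M, hM⟩ := (isCompact_Icc.image (hq j)).bddAbove
      exact ⟨M, fun x hx => hM (Set.mem_image_of_mem _ hx)⟩
    choose M hM using h
    refine ⟨∑ j, |M j|, fun j x hx => ((hM j x hx).trans (le_abs_self _)).trans ?_⟩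
    exact Finset.single_le_sum (f := fun j => |M j|) (fun _ _ => abs_nonneg _) (Finset.mem_univ j)
  set R := |M| + 1 with hR
  have hRpos : 0 < R := by positivity
  have hRM : M < R ^ 2 := by nlinarith [le_abs_self M, abs_nonneg M]
  set lo : ι ⊕ J → ℝ := Sum.elim (fun i => σ i - 1) fun _ => -R with hlo
  set hi : ι ⊕ J → ℝ := Sum.elim (fun i => σ i + 1) fun _ => R with hhi
  set b : ι ⊕ J → ℝ := Sum.elim a fun j => Real.sqrt (q j a) with hb
  have haI : a ∈ Set.Icc (fun i => σ i - 1) (fun i => σ i + 1) :=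
    ⟨fun i => by linarith [(abs_lt.1 (hcoord a haσ i)).1],
      fun i => by linarith [(abs_lt.1 (hcoord a haσ i)).2]⟩
  have hbI : b ∈ Set.Icc lo hi := by
    refine ⟨?_, ?_⟩
    · rintro (i | j)
      · exact haI.1 i
      · exact (neg_nonpos.2 hRpos.le).trans (Real.sqrt_nonneg _)
    · rintro (i | j)
      · exact haI.2 i
      · refine Real.sqrt_le_iff.2 ⟨hRpos.le, (hM j a haI).trans hRM.le⟩
  let Φ : (Option (ι ⊕ J) → ℝ) → (ι ⊕ J → ℝ) → ℝ := fun θ z =>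
    (θ none * ∑ i, (z (.inl i) - σ i) ^ 2 +
      1 / 2 * ∑ j, (q j (fun i => z (.inl i)) - z (.inr j) ^ 2) ^ 2) - ∑ v, θ (some v) * z v
  have hΦ : ∀ θ, Continuous (Φ θ) := fun θ => by
    have := fun j => (hq j).comp (f := fun z : ι ⊕ J → ℝ => fun i => z (.inl i)) (by fun_prop)
    simp only [Function.comp_def] at this
    fun_prop
  have hmin : ∀ θ, ∃ z ∈ Set.Icc lo hi, IsMinOn (Φ θ) (Set.Icc lo hi) z := fun θ =>
    isCompact_Icc.exists_isMinOn ⟨b, hbI⟩ (hΦ θ).continuousOn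
  choose y hyI hymin using hmin
  obtain ⟨y₀, hy₀I, hlim⟩ := (isCompact_Icc (a := lo) (b := hi)).ultrafilter_le_nhds
    (U.map y) (le_principal_iff.2 (Filter.mem_map.2 (univ_mem' hyI)))
  have hlim : Tendsto y (U : Filter (Option (ι ⊕ J) → ℝ)) (𝓝 y₀) := hlim
  set W := ∑ v, (hi v - lo v) with hW
  have hWnn : 0 ≤ W := Finset.sum_nonneg fun v _ => sub_nonneg.2 (hbI.1.trans hbI.2 v)
  have hkey : ∀ δ : ℝ, 0 < δ → ∀ᶠ θ in (U : Filter (Option (ι ⊕ J) → ℝ)), 0 < θ none ∧ θ none < δ ∧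
      θ none * ∑ i, (y θ (.inl i) - σ i) ^ 2 +
        1 / 2 * ∑ j, (q j (fun i => y θ (.inl i)) - y θ (.inr j) ^ 2) ^ 2 ≤
          θ none * (∑ i, (a i - σ i) ^ 2 + δ * W) := by
    intro δ hδ
    filter_upwards [hU δ hδ] with θ hθ
    refine ⟨hθ.1, hθ.2.1, ?_⟩
    have h1 : Φ θ (y θ) ≤ Φ θ b := hymin θ hbI
    have h2 : Φ θ b = θ none * ∑ i, (a i - σ i) ^ 2 - ∑ v, θ (some v) * b v := by
      have h0 : ∑ j, (q j (fun i => b (.inl i)) - b (.inr j) ^ 2) ^ 2 = 0 := by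
        refine Finset.sum_eq_zero fun j _ => ?_
        show (q j a - Real.sqrt (q j a) ^ 2) ^ 2 = 0
        rw [Real.sq_sqrt (ha j), sub_self]
        norm_num
      simp only [Φ]
      rw [h0, mul_zero, add_zero]
      rfl
    have h3 : ∑ v, θ (some v) * y θ v - ∑ v, θ (some v) * b v ≤ θ none * (δ * W) := by
      rw [← Finset.sum_sub_distrib, hW, Finset.mul_sum, Finset.mul_sum]
      refine Finset.sum_le_sum fun v _ => ?_
      rw [← mul_sub]
      refine (le_abs_self _).trans ?_
      rw [abs_mul, ← mul_assoc, mul_comm (θ none)]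
      refine mul_le_mul (hθ.2.2 v).le ?_ (abs_nonneg _) (mul_nonneg hδ.le hθ.1.le)
      rw [abs_le]
      constructor <;> linarith [(hyI θ).1 v, (hyI θ).2 v, hbI.1 v, hbI.2 v]
    rw [h2] at h1
    simp only [Φ] at h1
    linarith
  have hpos1 : ∀ θ, 0 ≤ ∑ i, (y θ (.inl i) - σ i) ^ 2 := fun θ =>
    Finset.sum_nonneg fun _ _ => sq_nonneg _
  have hpos2 : ∀ θ, 0 ≤ ∑ j, (q j (fun i => y θ (.inl i)) - y θ (.inr j) ^ 2) ^ 2 := fun θ =>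
    Finset.sum_nonneg fun _ _ => sq_nonneg _
  have hapos : 0 ≤ ∑ i, (a i - σ i) ^ 2 := Finset.sum_nonneg fun _ _ => sq_nonneg _
  have hlimS : Tendsto (fun θ => ∑ i, (y θ (.inl i) - σ i) ^ 2)
      (U : Filter (Option (ι ⊕ J) → ℝ)) (𝓝 (∑ i, (y₀ (.inl i) - σ i) ^ 2)) :=
    ((by fun_prop : Continuous fun z : ι ⊕ J → ℝ => ∑ i, (z (.inl i) - σ i) ^ 2).tendsto y₀).comp hlim
  have hlimq : Tendsto (fun θ => ∑ j, (q j (fun i => y θ (.inl i)) - y θ (.inr j) ^ 2) ^ 2)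
      (U : Filter (Option (ι ⊕ J) → ℝ))
      (𝓝 (∑ j, (q j (fun i => y₀ (.inl i)) - y₀ (.inr j) ^ 2) ^ 2)) := by
    have := fun j => (hq j).comp (f := fun z : ι ⊕ J → ℝ => fun i => z (.inl i)) (by fun_prop)
    simp only [Function.comp_def] at this
    exact ((by fun_prop : Continuous fun z : ι ⊕ J → ℝ =>
      ∑ j, (q j (fun i => z (.inl i)) - z (.inr j) ^ 2) ^ 2).tendsto y₀).comp hlim
  have hS : ∑ i, (y₀ (.inl i) - σ i) ^ 2 ≤ ∑ i, (a i - σ i) ^ 2 := by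
    refine le_of_forall_pos_le_add fun δ hδ => ?_
    refine le_of_tendsto hlimS ?_
    filter_upwards [hkey (δ / (W + 1)) (by positivity)] with θ hθ
    have h1 : θ none * ∑ i, (y θ (.inl i) - σ i) ^ 2 ≤
        θ none * (∑ i, (a i - σ i) ^ 2 + δ / (W + 1) * W) := by linarith [hpos2 θ, hθ.2.2]
    refine (le_of_mul_le_mul_left h1 hθ.1).trans (add_le_add_right ?_ _)
    rw [div_mul_eq_mul_div, div_le_iff₀ (by positivity)]
    nlinarith
  have hQ : ∑ j, (q j (fun i => y₀ (.inl i)) - y₀ (.inr j) ^ 2) ^ 2 ≤ 0 := by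
    refine le_of_forall_pos_le_add fun δ hδ => ?_
    refine le_of_tendsto hlimq ?_
    have hA : 0 < 2 * (1 + W) := by positivity
    filter_upwards [hkey (min 1 (δ / (2 * (1 + W)))) (by positivity)] with θ hθ
    have h0 : θ none < δ / (2 * (1 + W)) := hθ.2.1.trans_le (min_le_right _ _)
    rw [lt_div_iff₀ hA] at h0
    have h1 := mul_nonneg hθ.1.le (hpos1 θ)
    have h2 : ∑ i, (a i - σ i) ^ 2 + min 1 (δ / (2 * (1 + W))) * W ≤ 1 + W :=
      add_le_add haσ.le ((mul_le_mul_of_nonneg_right (min_le_left _ _) hWnn).trans (one_mul W).le)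
    have h3 := mul_le_mul_of_nonneg_left h2 hθ.1.le
    linarith [hθ.2.2]
  have hq0 : ∀ j, q j (fun i => y₀ (.inl i)) = y₀ (.inr j) ^ 2 := by
    intro j
    have h := (Finset.sum_eq_zero_iff_of_nonneg (fun _ _ => sq_nonneg _)).1
      (hQ.antisymm (Finset.sum_nonneg fun _ _ => sq_nonneg _)) j (Finset.mem_univ j)
    exact sub_eq_zero.1 (pow_eq_zero_iff two_ne_zero |>.1 h)
  refine ⟨y₀, y, hlim, hS, hq0, ?_⟩
  have hmem₀ : y₀ ∈ Set.pi Set.univ fun v => Set.Ioo (lo v) (hi v) := by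
    have hx := hcoord (fun i => y₀ (.inl i)) (hS.trans_lt haσ)
    rintro (i | j) -
    · have := abs_lt.1 (hx i)
      exact ⟨by simp only [hlo, Sum.elim_inl]; linarith, by simp only [hhi, Sum.elim_inl]; linarith⟩
    · have h1 : y₀ (.inr j) ^ 2 < R ^ 2 := by
        rw [← hq0 j]
        exact (hM j _ ⟨fun i => hy₀I.1 (.inl i), fun i => hy₀I.2 (.inl i)⟩).trans_lt hRM
      exact abs_lt.1 (abs_lt_of_sq_lt_sq h1 hRpos.le)
  have hopen : IsOpen (Set.pi Set.univ fun v => Set.Ioo (lo v) (hi v)) :=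
    isOpen_set_pi Set.finite_univ fun v _ => isOpen_Ioo
  filter_upwards [hlim (hopen.mem_nhds hmem₀)] with θ hθ
  refine (hymin θ).isLocalMin (mem_of_superset (hopen.mem_nhds hθ) fun z hz => ?_)
  exact ⟨fun v => (hz v trivial).1.le, fun v => (hz v trivial).2.le⟩

theorem totalDegree_pderiv_le {V : Type*} (v : V) (p : MvPolynomial V ℝ) :
    (MvPolynomial.pderiv v p).totalDegree ≤ p.totalDegree := by
  classical
  conv_lhs => rw [p.as_sum, map_sum]
  refine MvPolynomial.totalDegree_finsetSum_le fun b hb => ?_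
  rw [MvPolynomial.pderiv_monomial]
  refine (MvPolynomial.totalDegree_monomial_le _ _).trans
    (le_trans ?_ (MvPolynomial.le_totalDegree hb))
  exact Finsupp.degree_mono tsub_le_self

theorem hasDerivAt_eval_update {V : Type*} [DecidableEq V] (x : V → ℝ) (v : V)
    (p : MvPolynomial V ℝ) :
    HasDerivAt (fun t => MvPolynomial.eval (Function.update x v t) p)
      (MvPolynomial.eval x (MvPolynomial.pderiv v p)) (x v) := by
  induction p using MvPolynomial.induction_on with
  | C a => simpa using hasDerivAt_const (x v) a
  | add p q hp hq => simpa only [map_add] using hp.fun_add hq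
  | mul_X p w hp =>
    have hw : HasDerivAt (fun t => MvPolynomial.eval (Function.update x v t)
        (MvPolynomial.X w : MvPolynomial V ℝ))
        (MvPolynomial.eval x (MvPolynomial.pderiv v (MvPolynomial.X w))) (x v) := by
      by_cases h : w = v
      · subst h
        simpa using hasDerivAt_id' (x w)
      · simpa [h, MvPolynomial.pderiv_X_of_ne h] using hasDerivAt_const (x v) (x w)
    have := hp.fun_mul hw
    simp only [← map_mul, Function.update_eq_self, ← map_add] at this
    rwa [Derivation.leibniz, smul_eq_mul, smul_eq_mul, add_comm, mul_comm (MvPolynomial.X w)]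

/-- Semialgebraic curve selection with an explicit complexity bound: near `σ`, the feasible set of
polynomial inequalities of degree at most `d` contains points from a set `C` on which more than
`(2d+2)^(|ι|+|J|+2)` polynomials are linearly dependent over the polynomials in the
parameter `z none`. -/
theorem exists_algebraic_selection {ι J : Type*} [Fintype ι] [Fintype J] {d : ℕ} (hd : 1 ≤ d)
    (q : J → MvPolynomial (Option ι) ℝ) (hq : ∀ j, (q j).totalDegree ≤ d) (σ : ι → ℝ) :
    ∃ C : Set (Option ι → ℝ),
      (∀ (r : ℕ) (g : Fin r → MvPolynomial (Option ι) ℝ),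
        (2 * d + 2) ^ (Fintype.card ι + Fintype.card J + 2) < r →
        ∃ Q : Fin r → Polynomial ℝ, Q ≠ 0 ∧
          ∀ z ∈ C, ∑ a, MvPolynomial.eval z (g a) * (Q a).eval (z none) = 0) ∧
      ∀ z : Option ι → ℝ, (∀ j, 0 ≤ MvPolynomial.eval z (q j)) →
        ∑ i, (z (some i) - σ i) ^ 2 < 1 →
        ∃ z' ∈ C, z' none = z none ∧
          ∑ i, (z' (some i) - σ i) ^ 2 ≤ ∑ i, (z (some i) - σ i) ^ 2 ∧
          ∀ j, 0 ≤ MvPolynomial.eval z' (q j) := by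
  classical
  obtain ⟨U, hU1, hU2⟩ := exists_generic_ultrafilter (ι ⊕ J)
  let e : Option ι → Option (Option (ι ⊕ J)) := (Option.elim · none fun i => some (some (.inl i)))
  let y' : ι ⊕ J → MvPolynomial (Option (Option (ι ⊕ J))) ℝ := fun v => .X (some (some v))
  let H : MvPolynomial (Option (Option (ι ⊕ J))) ℝ :=
    .X (some none) * ∑ i, (y' (.inl i) - .C (σ i)) ^ 2 +
      .C (1 / 2) * ∑ j, (MvPolynomial.rename e (q j) - y' (.inr j) ^ 2) ^ 2
  let f : ι ⊕ J → MvPolynomial (Option (Option (ι ⊕ J))) ℝ := fun v =>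
    MvPolynomial.pderiv (some (some v)) H
  have hHdeg : H.totalDegree ≤ 2 * d + 2 := by
    have hy : ∀ v, (y' v).totalDegree ≤ 1 := fun v => (MvPolynomial.totalDegree_X _).le
    refine (MvPolynomial.totalDegree_add _ _).trans (max_le ?_ ?_)
    · refine (MvPolynomial.totalDegree_mul _ _).trans ?_
      rw [MvPolynomial.totalDegree_X]
      have : (∑ i, (y' (.inl i) - MvPolynomial.C (σ i)) ^ 2).totalDegree ≤ 2 := by
        refine MvPolynomial.totalDegree_finsetSum_le fun i _ => ?_
        refine (MvPolynomial.totalDegree_pow _ _).trans ?_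
        have := (MvPolynomial.totalDegree_sub_C_le (y' (.inl i)) (σ i)).trans (hy _)
        omega
      omega
    · refine (MvPolynomial.totalDegree_mul _ _).trans ?_
      rw [MvPolynomial.totalDegree_C, zero_add]
      refine MvPolynomial.totalDegree_finsetSum_le fun j _ => ?_
      refine (MvPolynomial.totalDegree_pow _ _).trans ?_
      have h1 := MvPolynomial.totalDegree_sub (MvPolynomial.rename e (q j)) (y' (.inr j) ^ 2)
      have h2 := MvPolynomial.totalDegree_pow (y' (.inr j)) 2
      have h3 := hy (.inr j)
      have h4 := (MvPolynomial.totalDegree_rename_le e (q j)).trans (hq j)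
      have h5 := max_le (h4.trans (by omega : d ≤ d + 1)) (h2.trans (by omega : _ ≤ d + 1))
      omega
  have hHeval : ∀ ε η (y : ι ⊕ J → ℝ), MvPolynomial.eval (Option.elim · ε (Option.elim · η y)) H =
      η * ∑ i, (y (.inl i) - σ i) ^ 2 +
        1 / 2 * ∑ j, (MvPolynomial.eval (Option.elim · ε fun i => y (.inl i)) (q j) -
          y (.inr j) ^ 2) ^ 2 := by
    intro ε η y
    have he : (fun o : Option (Option (ι ⊕ J)) => o.elim ε (Option.elim · η y)) ∘ e =
        (Option.elim · ε fun i => y (.inl i)) := by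
      funext o
      cases o <;> rfl
    simp [H, y', MvPolynomial.eval_rename, he]
  refine ⟨{z | ∃ (y₀ : ι ⊕ J → ℝ) (y : (Option (ι ⊕ J) → ℝ) → ι ⊕ J → ℝ),
      (∀ i, z (some i) = y₀ (.inl i)) ∧
      Filter.Tendsto y (U : Filter (Option (ι ⊕ J) → ℝ)) (nhds y₀) ∧
      ∀ᶠ θ in (U : Filter (Option (ι ⊕ J) → ℝ)), ∀ v,
        MvPolynomial.eval (Option.elim · (z none) (Option.elim · (θ none) (y θ))) (f v) =
          θ (some v)}, ?_, ?_⟩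
  · intro r g hr
    have hU0 : Filter.Tendsto (fun θ : Option (ι ⊕ J) → ℝ => θ none)
        (U : Filter (Option (ι ⊕ J) → ℝ)) (nhds 0) := by
      rw [Metric.tendsto_nhds]
      intro δ hδ
      filter_upwards [hU2 δ hδ] with θ hθ
      rw [Real.dist_eq, sub_zero, abs_of_pos hθ.1]
      exact hθ.2.1
    obtain ⟨Q, hQ, h⟩ := exists_relation_of_generic_limit U hU1 hU0 (by omega) f
      (fun v => (totalDegree_pderiv_le _ _).trans hHdeg) (fun a => MvPolynomial.rename e (g a))
      (by rwa [Fintype.card_sum])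
    refine ⟨Q, hQ, ?_⟩
    rintro z ⟨y₀, y, hz, hy, hcrit⟩
    have h1 := h (z none) y₀ y hy hcrit
    have he : (fun o : Option (Option (ι ⊕ J)) => o.elim (z none) (Option.elim · 0 y₀)) ∘ e = z := by
      funext o
      cases o with
      | none => rfl
      | some i => exact (hz i).symm
    simpa only [MvPolynomial.eval_rename, he] using h1
  · intro z hz hzσ
    have hzz : Continuous fun x : ι → ℝ => (Option.elim · (z none) x : Option ι → ℝ) :=
      continuous_pi fun o => by
        cases o with
        | none => exact continuous_const
        | some i => exact continuous_apply i
    have hz' : (Option.elim · (z none) fun i => z (some i)) = z := by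
      funext o
      cases o <;> rfl
    obtain ⟨y₀, y, hy, hS, hq0, hmin⟩ := exists_limit_penalized_minimizers U hU2
      (fun j x => MvPolynomial.eval (Option.elim · (z none) x) (q j))
      (fun j => (MvPolynomial.continuous_eval _).comp hzz) σ (fun i => z (some i))
      (by simpa only [hz'] using hz) hzσ
    refine ⟨(Option.elim · (z none) fun i => y₀ (.inl i)), ⟨y₀, y, fun _ => rfl, hy, ?_⟩, rfl, hS,
      fun j => (sq_nonneg _).trans_eq (hq0 j).symm⟩
    filter_upwards [hmin] with θ hθ v
    have hup : ∀ t, (Option.elim · (z none) (Option.elim · (θ none) (Function.update (y θ) v t))) =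
        Function.update (Option.elim · (z none) (Option.elim · (θ none) (y θ)) :
          Option (Option (ι ⊕ J)) → ℝ) (some (some v)) t := by
      intro t
      funext o
      rcases o with (_ | _ | w)
      · rfl
      · rfl
      · simp [Function.update_apply]
    have h1 := hasDerivAt_eval_update (Option.elim · (z none) (Option.elim · (θ none) (y θ)) :
          Option (Option (ι ⊕ J)) → ℝ) (some (some v)) H
    simp only [← hup, hHeval, Option.elim_some] at h1
    have h2 : HasDerivAt (fun t => ∑ w, θ (some w) * Function.update (y θ) v t w)
        (θ (some v)) (y θ v) := by
      have h3 : ∀ w ∈ Finset.univ, HasDerivAt (fun t => θ (some w) * Function.update (y θ) v t w)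
          (if w = v then θ (some v) else 0) (y θ v) := by
        intro w _
        by_cases hw : w = v
        · subst hw
          simpa using (hasDerivAt_id' (y θ w)).const_mul (θ (some w))
        · simpa [hw] using hasDerivAt_const (y θ v) (θ (some w) * y θ w)
      simpa using HasDerivAt.fun_sum h3
    have hmin' : IsLocalMin ((fun w : ι ⊕ J → ℝ => (θ none * ∑ i, (w (.inl i) - σ i) ^ 2 +
          1 / 2 * ∑ j, (MvPolynomial.eval (Option.elim · (z none) fun i => w (.inl i)) (q j) -
            w (.inr j) ^ 2) ^ 2) - ∑ v, θ (some v) * w v) ∘ Function.update (y θ) v) (y θ v) := by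
      have hc : Continuous (Function.update (y θ) v) := continuous_const.update v continuous_id
      refine IsLocalMin.comp_continuous ?_ hc.continuousAt
      rwa [Function.update_eq_self]
    have := hmin'.hasDerivAt_eq_zero (h1.fun_sub h2)
    exact sub_eq_zero.1 this

theorem eval₂_eq_coeff_zero_add {E : Type*} [Field E] [LinearOrder E] (φ : ℝ →+*o E)
    (x : E) (p : Polynomial ℝ) :
    p.eval₂ (φ : ℝ →+* E) x =
      φ (p.coeff 0) + x * p.divX.eval₂ (φ : ℝ →+* E) x := by
  conv_lhs => rw [← Polynomial.X_mul_divX_add p]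
  rw [Polynomial.eval₂_add, Polynomial.eval₂_mul, Polynomial.eval₂_X, Polynomial.eval₂_C, add_comm]
  rfl

section Valuation

open ArchimedeanClass

variable {E : Type*} [Field E] [LinearOrder E] [IsStrictOrderedRing E]

theorem mk_mul_le_mk_mul_iff_left {a b c : E} (hc : c ≠ 0) : mk (c * a) ≤ mk (c * b) ↔ mk a ≤ mk b := by
  have h : ∀ {a b c : E}, mk a ≤ mk b → mk (c * a) ≤ mk (c * b) := fun {a b c} h => by
    rw [mk_mul, mk_mul]
    exact add_le_add_right h _
  refine ⟨fun h1 => ?_, h⟩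
  simpa [hc] using h (c := c⁻¹) h1

theorem mk_mul_lt_mk_mul_iff_left {a b c : E} (hc : c ≠ 0) : mk (c * a) < mk (c * b) ↔ mk a < mk b := by
  rw [← not_le, ← not_le, mk_mul_le_mk_mul_iff_left hc]

theorem mk_le_mk_mul_of_nonneg {a b : E} (ha : 0 ≤ mk a) : mk b ≤ mk (a * b) := by
  rw [mk_mul]
  exact le_add_of_nonneg_left ha

theorem mk_lt_mk_mul_of_pos {a b : E} (ha : 0 < mk a) (hb : b ≠ 0) : mk b < mk (a * b) := by
  rw [mul_comm]
  conv_lhs => rw [← mul_one b]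
  rwa [mk_mul_lt_mk_mul_iff_left hb]

theorem mk_mul_nonneg {a b : E} (ha : 0 ≤ mk a) (hb : 0 ≤ mk b) : 0 ≤ mk (a * b) :=
  hb.trans (mk_le_mk_mul_of_nonneg ha)

variable (φ : ℝ →+*o E)

theorem mk_eval₂_nonneg {x : E} (hx : 0 ≤ mk x) (p : Polynomial ℝ) :
    0 ≤ mk (p.eval₂ (φ : ℝ →+* E) x) := by
  induction p using Polynomial.induction_on' with
  | add p q hp hq =>
    rw [Polynomial.eval₂_add]
    exact (le_min hp hq).trans (min_le_mk_add _ _)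
  | monomial n a =>
    rw [Polynomial.eval₂_monomial]
    refine mk_mul_nonneg (mk_map_nonneg_of_archimedean φ a) ?_
    rw [mk_pow]
    exact nsmul_nonneg hx n

theorem mk_eval₂_eq_zero {x : E} (hx : 0 < mk x) (p : Polynomial ℝ) (hp : p.coeff 0 ≠ 0) :
    mk (p.eval₂ (φ : ℝ →+* E) x) = 0 := by
  rw [eval₂_eq_coeff_zero_add, mk_add_eq_mk_left]
  · exact mk_map_of_archimedean' φ hp
  · rw [mk_map_of_archimedean' φ hp, mul_comm]
    exact hx.trans_le (mk_le_mk_mul_of_nonneg (mk_eval₂_nonneg φ hx.le _))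

theorem mk_pow_le_mk_eval₂_of_X_pow_dvd {x : E} (hx : 0 ≤ mk x) {p : Polynomial ℝ} {n : ℕ}
    (h : Polynomial.X ^ n ∣ p) : mk (x ^ n) ≤ mk (p.eval₂ (φ : ℝ →+* E) x) := by
  obtain ⟨q, rfl⟩ := h
  rw [Polynomial.eval₂_mul, Polynomial.eval₂_X_pow, mul_comm]
  exact mk_le_mk_mul_of_nonneg (mk_eval₂_nonneg φ hx q)

theorem mk_pow_strictMono {x : E} (hx : 0 < mk x) (hx0 : x ≠ 0) : StrictMono fun n => mk (x ^ n) :=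
  strictMono_nat_of_lt_succ fun n => by
    rw [pow_succ']
    exact mk_lt_mk_mul_of_pos hx (pow_ne_zero n hx0)

/-- Elements of widely separated magnitudes are linearly independent over `ℝ[ε]`. -/
theorem exists_mk_mul_le_of_relation {r : ℕ} {ε : E} (hε : 0 < mk ε) (hε0 : ε ≠ 0) (h : Fin r → E)
    (hmono : StrictMono fun a => mk (h a)) (Q : Fin r → Polynomial ℝ) (hQ : Q ≠ 0)
    (hrel : ∑ a, h a * (Q a).eval₂ (φ : ℝ →+* E) ε = 0) :
    ∃ a b, mk (ε * h b) ≤ mk (h a) := by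
  classical
  by_contra! hlt
  obtain ⟨a₁, ha₁⟩ := Function.ne_iff.1 hQ
  have hex : ∃ k, ∃ a, (Q a).coeff k ≠ 0 :=
    ⟨_, a₁, Polynomial.leadingCoeff_ne_zero.2 ha₁⟩
  have hmin : ∀ a, Polynomial.X ^ Nat.find hex ∣ Q a := fun a => by
    rw [Polynomial.X_pow_dvd_iff]
    intro m hm
    by_contra hne
    exact Nat.find_min hex hm ⟨a, hne⟩
  choose R hR using hmin
  obtain ⟨a₂, ha₂⟩ := Nat.find_spec hex
  have hR0 : (R a₂).coeff 0 ≠ 0 := by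
    rw [hR a₂] at ha₂
    rwa [Polynomial.coeff_X_pow_mul', if_pos le_rfl, Nat.sub_self] at ha₂
  obtain ⟨a₀, ha₀, hfirst⟩ : ∃ a₀, (R a₀).coeff 0 ≠ 0 ∧ ∀ a < a₀, (R a).coeff 0 = 0 := by
    have hne : (Finset.univ.filter fun a => (R a).coeff 0 ≠ 0).Nonempty := ⟨a₂, by simpa using hR0⟩
    refine ⟨Finset.min' _ hne, by simpa using Finset.min'_mem _ hne, fun a ha => ?_⟩
    by_contra hne'
    exact (Finset.min'_le _ a (by simpa using hne')).not_gt ha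
  have hrel' : ∑ a, h a * (R a).eval₂ (φ : ℝ →+* E) ε = 0 := by
    have h1 : ε ^ Nat.find hex * ∑ a, h a * (R a).eval₂ (φ : ℝ →+* E) ε = 0 := by
      rw [← hrel, Finset.mul_sum]
      refine Finset.sum_congr rfl fun a _ => ?_
      conv_rhs => rw [hR a, Polynomial.eval₂_mul, Polynomial.eval₂_X_pow]
      ring
    exact (mul_eq_zero.1 h1).resolve_left (pow_ne_zero _ hε0)
  have hv0 : mk (h a₀ * (R a₀).eval₂ (φ : ℝ →+* E) ε) = mk (h a₀) := by
    rw [mk_mul, mk_eval₂_eq_zero φ hε _ ha₀, add_zero]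
  have htop : mk (h a₀) ≠ ⊤ := ((hlt a₀ a₀).trans_le le_top).ne
  have hsum := (addValuation E).map_lt_sum (s := Finset.univ.erase a₀)
    (f := fun a => h a * (R a).eval₂ (φ : ℝ →+* E) ε) htop (by
      intro a ha
      rw [addValuation_apply]
      rcases lt_or_gt_of_ne (Finset.ne_of_mem_erase ha) with hlt' | hgt
      · have h1 : Polynomial.X ^ 1 ∣ R a := by
          rw [pow_one, Polynomial.X_dvd_iff]
          exact hfirst a hlt'
        have h2 := mk_pow_le_mk_eval₂_of_X_pow_dvd φ hε.le h1
        rw [pow_one] at h2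
        refine (hlt a₀ a).trans_le ?_
        rw [mul_comm, mk_mul, mk_mul]
        exact add_le_add_right h2 _
      · refine (hmono hgt).trans_le ?_
        rw [mul_comm]
        exact mk_le_mk_mul_of_nonneg (mk_eval₂_nonneg φ hε.le _))
  rw [addValuation_apply] at hsum
  rw [← Finset.add_sum_erase _ _ (Finset.mem_univ a₀), add_eq_zero_iff_eq_neg] at hrel'
  rw [← hv0, hrel', mk_neg] at hsum
  exact lt_irrefl _ hsum

variable {φ} {F : Subfield E} {ε : E} {B : ℕ}

/-- If all chains of infinitesimals between `1` and `ε` in `F` have bounded length, there is a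
largest magnitude of infinitesimals, and `ε` is not much smaller than one of its powers. -/
theorem exists_uniformizer (hε : 0 < mk ε) (hε0 : ε ≠ 0) (hεF : ε ∈ F)
    (hchain : ∀ h : ℕ → E, (∀ a, h a ∈ F) → (∀ a < B, mk (h a) < mk (h (a + 1))) →
      mk (ε * h 0) ≤ mk (h B)) :
    ∃ π ∈ F, 0 < π ∧ 0 < mk π ∧ (∀ f ∈ F, 0 < mk f → mk π ≤ mk f) ∧ mk ε ≤ mk (π ^ B) := by
  obtain ⟨π, hπF, hπ, hmax⟩ : ∃ π ∈ F, 0 < mk π ∧ ∀ f ∈ F, 0 < mk f → mk π ≤ mk f := by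
    by_contra! hno
    choose! next hnF hnpos hnlt using hno
    have hk : ∀ n, next^[n] ε ∈ F ∧ 0 < mk (next^[n] ε) := by
      intro n
      induction n with
      | zero => exact ⟨hεF, hε⟩
      | succ n ih =>
        rw [Function.iterate_succ_apply']
        exact ⟨hnF _ ih.1 ih.2, hnpos _ ih.1 ih.2⟩
    have hlt : ∀ n, mk (next^[n + 1] ε) < mk (next^[n] ε) := fun n => by
      rw [Function.iterate_succ_apply']
      exact hnlt _ (hk n).1 (hk n).2
    have h := hchain (fun a => if a = 0 then 1 else next^[B + 1 - a] ε) ?_ ?_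
    · rcases Nat.eq_zero_or_pos B with rfl | hB
      · simp only [if_true, mul_one, mk_one] at h
        exact h.not_gt hε
      · simp only [if_true, mul_one, hB.ne', if_false, Nat.add_sub_cancel_left] at h
        exact h.not_gt (hlt 0)
    · intro a
      split_ifs
      · exact F.one_mem
      · exact (hk _).1
    · intro a ha
      rw [if_neg (Nat.succ_ne_zero a)]
      split_ifs with ha0
      · exact (hk _).2
      · have : B + 1 - a = (B + 1 - (a + 1)) + 1 := by omega
        rw [this]
        exact hlt _
  have hπ0 : π ≠ 0 := by
    rintro rfl
    have := hmax ε hεF hε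
    rw [mk_zero, top_le_iff, mk_eq_top_iff] at this
    exact hε0 this
  refine ⟨|π|, ?_, abs_pos.2 hπ0, by rwa [mk_abs], by simpa only [mk_abs] using hmax, ?_⟩
  · rcases abs_choice π with h | h <;> rw [h]
    · exact hπF
    · exact F.neg_mem hπF
  · have := hchain (fun a => |π| ^ a) ?_ fun a _ => ?_
    · simpa using this
    · intro a
      refine F.pow_mem ?_ a
      rcases abs_choice π with h | h <;> rw [h]
      · exact hπF
      · exact F.neg_mem hπF
    · exact mk_pow_strictMono (by rwa [mk_abs]) (abs_ne_zero.2 hπ0) (Nat.lt_succ_self a)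

/-- Power series expansion in a uniformizer. -/
theorem exists_polynomial_approx (hφF : ∀ c, φ c ∈ F) {π : E} (hπF : π ∈ F) (hπ0 : π ≠ 0)
    (hmax : ∀ f ∈ F, 0 < mk f → mk π ≤ mk f) (K : ℕ) :
    ∀ f ∈ F, 0 ≤ mk f → ∃ p : Polynomial ℝ, p.natDegree ≤ K ∧ p.coeff 0 = stdPart f ∧
      mk (π ^ (K + 1)) ≤ mk (f - p.eval₂ (φ : ℝ →+* E) π) := by
  induction K with
  | zero =>
    intro f hf hf0
    refine ⟨Polynomial.C (stdPart f), by simp, by simp, ?_⟩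
    rw [zero_add, pow_one, Polynomial.eval₂_C]
    exact hmax _ (F.sub_mem hf (hφF _)) (mk_sub_stdPart_pos φ hf0)
  | succ K ih =>
    intro f hf hf0
    have h1 := hmax _ (F.sub_mem hf (hφF _)) (mk_sub_stdPart_pos φ hf0)
    have hf1 : f - φ (stdPart f) = π * ((f - φ (stdPart f)) / π) := by field_simp
    have h2 : 0 ≤ mk ((f - φ (stdPart f)) / π) := by
      rw [hf1] at h1
      nth_rw 1 [← mul_one π] at h1
      rwa [mk_mul_le_mk_mul_iff_left hπ0, mk_one] at h1
    obtain ⟨p, hp, -, hp2⟩ := ih _ (F.div_mem (F.sub_mem hf (hφF _)) hπF) h2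
    refine ⟨Polynomial.C (stdPart f) + Polynomial.X * p, ?_, by simp, ?_⟩
    · refine (Polynomial.natDegree_add_le _ _).trans (max_le (by simp) ?_)
      refine Polynomial.natDegree_mul_le.trans ?_
      rw [Polynomial.natDegree_X]
      omega
    · rw [Polynomial.eval₂_add, Polynomial.eval₂_C, Polynomial.eval₂_mul, Polynomial.eval₂_X,
        RingHom.coe_coe, ← sub_sub, hf1, ← mul_sub, pow_succ', mk_mul_le_mk_mul_iff_left hπ0]
      exact hp2

theorem natTrailingDegree_le_of_approx {π : E} (hπ : 0 < mk π) (hπ0 : π ≠ 0) {K m : ℕ} (hmK : m ≤ K)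
    {f : E} {p : Polynomial ℝ} (hp : mk (π ^ (K + 1)) ≤ mk (f - p.eval₂ (φ : ℝ →+* E) π))
    (hf : mk f ≤ mk (π ^ m)) : p ≠ 0 ∧ p.natTrailingDegree ≤ m := by
  have hmono := mk_pow_strictMono hπ hπ0
  by_contra hcon
  have hdvd : Polynomial.X ^ (m + 1) ∣ p := by
    rw [Polynomial.X_pow_dvd_iff]
    intro i hi
    by_cases h0 : p = 0
    · simp [h0]
    · refine Polynomial.coeff_eq_zero_of_lt_natTrailingDegree ?_
      have := not_le.1 fun h => hcon ⟨h0, h⟩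
      omega
  have h1 := mk_pow_le_mk_eval₂_of_X_pow_dvd φ hπ.le hdvd
  have h2 : mk (π ^ (m + 1)) ≤ mk f := by
    rw [← sub_add_cancel f (p.eval₂ (φ : ℝ →+* E) π)]
    refine (le_min ?_ h1).trans (min_le_mk_add _ _)
    exact (hmono.monotone (by omega : m + 1 ≤ K + 1)).trans hp
  exact (h2.trans hf).not_gt (hmono (Nat.lt_succ_self m))

theorem trailingCoeff_pos_of_approx {π : E} (hπ : 0 < mk π) (hπ0 : 0 < π) {K : ℕ} {f : E}
    {p : Polynomial ℝ} (hp : mk (π ^ (K + 1)) ≤ mk (f - p.eval₂ (φ : ℝ →+* E) π))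
    (hf : 0 ≤ f) (hp0 : p ≠ 0) (hpK : p.natTrailingDegree ≤ K) : 0 < p.trailingCoeff := by
  set m := p.natTrailingDegree with hm
  have hc : p.trailingCoeff ≠ 0 := Polynomial.trailingCoeff_nonzero_iff_nonzero.2 hp0
  obtain ⟨q, hq⟩ : Polynomial.X ^ m ∣ p := by
    rw [Polynomial.X_pow_dvd_iff]
    exact fun i hi => Polynomial.coeff_eq_zero_of_lt_natTrailingDegree hi
  have hq0 : q.coeff 0 = p.trailingCoeff := by
    rw [Polynomial.trailingCoeff, ← hm, hq, Polynomial.coeff_X_pow_mul', if_pos le_rfl, Nat.sub_self]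
  have hπm : 0 < π ^ m := pow_pos hπ0 m
  have hinf : 0 < mk (f / π ^ m - φ (q.coeff 0)) := by
    have h1 : f / π ^ m - φ (q.coeff 0) = (f - p.eval₂ (φ : ℝ →+* E) π) / π ^ m +
        π * q.divX.eval₂ (φ : ℝ →+* E) π := by
      rw [hq, Polynomial.eval₂_mul, Polynomial.eval₂_X_pow, eval₂_eq_coeff_zero_add]
      field_simp
      ring
    rw [h1]
    refine lt_of_lt_of_le (lt_min ?_ ?_) (min_le_mk_add _ _)
    · rw [← mk_one, ← mk_mul_lt_mk_mul_iff_left hπm.ne', mul_one, mul_div_cancel₀ _ hπm.ne']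
      exact (mk_pow_strictMono hπ hπ0.ne' (by omega : m < K + 1)).trans_le hp
    · rw [mul_comm]
      exact hπ.trans_le (mk_le_mk_mul_of_nonneg (mk_eval₂_nonneg φ hπ.le _))
  have hfin : 0 ≤ mk (f / π ^ m) := by
    rw [← sub_add_cancel (f / π ^ m) (φ (q.coeff 0))]
    exact (le_min hinf.le (mk_map_nonneg_of_archimedean φ _)).trans (min_le_mk_add _ _)
  have hst := (mk_sub_pos_iff φ hfin).1 hinf
  rw [hq0] at hst
  refine lt_of_le_of_ne ?_ hc.symm
  rw [← hst]
  exact stdPart_nonneg (div_nonneg hf hπm.le)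

theorem mk_sub_aeval_le {ι : Type*} {π : E} (hπ : 0 ≤ mk π) {m : ℕ} (x : ι → E)
    (X : ι → Polynomial ℝ) (hx : ∀ i, 0 ≤ mk (x i))
    (hX : ∀ i, mk (π ^ m) ≤ mk (x i - (X i).eval₂ (φ : ℝ →+* E) π)) (P : MvPolynomial ι ℝ) :
    mk (π ^ m) ≤ mk (P.eval₂ (φ : ℝ →+* E) x -
      (MvPolynomial.aeval X P).eval₂ (φ : ℝ →+* E) π) := by
  induction P using MvPolynomial.induction_on with
  | C a => simp
  | add P Q hP hQ =>
    rw [MvPolynomial.eval₂_add, map_add, Polynomial.eval₂_add, add_sub_add_comm]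
    exact (le_min hP hQ).trans (min_le_mk_add _ _)
  | mul_X P i hP =>
    rw [MvPolynomial.eval₂_mul, MvPolynomial.eval₂_X, map_mul, MvPolynomial.aeval_X,
      Polynomial.eval₂_mul]
    have h1 : ∀ a b c d : E, a * b - c * d = b * (a - c) + c * (b - d) := fun a b c d => by ring
    rw [h1]
    refine (le_min ?_ ?_).trans (min_le_mk_add _ _)
    · exact hP.trans (mk_le_mk_mul_of_nonneg (hx i))
    · exact (hX i).trans (mk_le_mk_mul_of_nonneg (mk_eval₂_nonneg φ hπ _))

theorem exists_polynomial_curve {ι : Type*} (hφF : ∀ c, φ c ∈ F) (hε : 0 < mk ε) (hε0 : 0 < ε)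
    (hεF : ε ∈ F)
    (hchain : ∀ h : ℕ → E, (∀ a, h a ∈ F) → (∀ a < B, mk (h a) < mk (h (a + 1))) →
      mk (ε * h 0) ≤ mk (h B))
    (x : ι → E) (hxF : ∀ i, x i ∈ F) (hx : ∀ i, 0 ≤ mk (x i)) (hεx : ∀ i, ε ≤ x i) {K : ℕ}
    (hBK : B ≤ K) :
    ∃ X : ι → Polynomial ℝ, (∀ i, (X i).natDegree ≤ K ∧ (X i).coeff 0 = stdPart (x i) ∧
        X i ≠ 0 ∧ (X i).natTrailingDegree ≤ B ∧ 0 < (X i).trailingCoeff) ∧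
      ∀ P : MvPolynomial ι ℝ, 0 ≤ P.eval₂ (φ : ℝ →+* E) x →
        MvPolynomial.aeval X P = 0 ∨ 0 < (MvPolynomial.aeval X P).trailingCoeff ∨
          K + 1 ≤ (MvPolynomial.aeval X P).natTrailingDegree := by
  obtain ⟨π, hπF, hπ0, hπ, hmax, hεπ⟩ := exists_uniformizer hε hε0.ne' hεF hchain
  choose X hXdeg hX0 hX using fun i =>
    exists_polynomial_approx hφF hπF hπ0.ne' hmax K (x i) (hxF i) (hx i)
  refine ⟨X, fun i => ?_, fun P hP => ?_⟩
  · have h1 : mk (x i) ≤ mk (π ^ B) := by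
      refine le_trans (mk_le_mk_of_abs ?_) hεπ
      rw [abs_of_pos hε0, abs_of_pos (hε0.trans_le (hεx i))]
      exact hεx i
    obtain ⟨h2, h3⟩ := natTrailingDegree_le_of_approx hπ hπ0.ne' hBK (hX i) h1
    exact ⟨hXdeg i, hX0 i, h2, h3, trailingCoeff_pos_of_approx hπ hπ0 (hX i)
      (hε0.le.trans (hεx i)) h2 (h3.trans hBK)⟩
  · have h1 := mk_sub_aeval_le hπ.le x X hx hX P
    by_cases h0 : MvPolynomial.aeval X P = 0
    · exact Or.inl h0
    · rcases le_or_gt (MvPolynomial.aeval X P).natTrailingDegree K with h2 | h2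
      · exact Or.inr (Or.inl (trailingCoeff_pos_of_approx hπ hπ0 h1 hP h0 h2))
      · exact Or.inr (Or.inr h2)

end Valuation

open ArchimedeanClass in
theorem chain_bound_of_relations {E V : Type*} [Field E] [LinearOrder E] [IsStrictOrderedRing E]
    (φ : ℝ →+*o E) {B : ℕ} (z : V → E) {ε : E} (hε : 0 < mk ε) (hε0 : ε ≠ 0)
    (hrel : ∀ g : Fin (B + 1) → MvPolynomial V ℝ, ∃ Q : Fin (B + 1) → Polynomial ℝ, Q ≠ 0 ∧
      ∑ a, (g a).eval₂ (φ : ℝ →+* E) z * (Q a).eval₂ (φ : ℝ →+* E) ε = 0)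
    (h : ℕ → E)
    (hF : ∀ a, h a ∈ Subfield.closure
      (Set.range fun P : MvPolynomial V ℝ => P.eval₂ (φ : ℝ →+* E) z))
    (hlt : ∀ a < B, mk (h a) < mk (h (a + 1))) : mk (ε * h 0) ≤ mk (h B) := by
  classical
  have hfrac : ∀ a, ∃ p q : MvPolynomial V ℝ, q.eval₂ (φ : ℝ →+* E) z ≠ 0 ∧
      p.eval₂ (φ : ℝ →+* E) z = h a * q.eval₂ (φ : ℝ →+* E) z := by
    intro a
    have hrange : (Set.range fun P : MvPolynomial V ℝ => P.eval₂ (φ : ℝ →+* E) z) =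
        ((MvPolynomial.eval₂Hom (φ : ℝ →+* E) z).range : Set E) := rfl
    have := hF a
    rw [hrange, Subfield.mem_closure_iff, Subring.closure_eq] at this
    obtain ⟨_, ⟨p, rfl⟩, _, ⟨q, rfl⟩, hpq⟩ := this
    simp only [MvPolynomial.coe_eval₂Hom] at hpq
    by_cases hq : q.eval₂ (φ : ℝ →+* E) z = 0
    · exact ⟨0, 1, by simp, by simp [← hpq, hq]⟩
    · exact ⟨p, q, hq, by rw [← hpq, div_mul_cancel₀ _ hq]⟩
  choose p q hq hpq using hfrac
  obtain ⟨Q, hQ, hsum⟩ := hrel fun a => p a * ∏ b ∈ Finset.univ.erase a, q b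
  have hmonoN : ∀ b ≤ B, ∀ a < b, mk (h a) < mk (h b) := by
    intro b hb
    induction b with
    | zero => intro a ha; omega
    | succ b ih =>
      intro a ha
      rcases Nat.lt_succ_iff_lt_or_eq.1 ha with hab | rfl
      · exact (ih (by omega) a hab).trans (hlt b (by omega))
      · exact hlt a (by omega)
  have hle : ∀ b ≤ B, ∀ a ≤ b, mk (h a) ≤ mk (h b) := fun b hb a hab => by
    rcases hab.lt_or_eq with hab | rfl
    · exact (hmonoN b hb a hab).le
    · exact le_rfl
  obtain ⟨a, b, hab⟩ := exists_mk_mul_le_of_relation φ hε hε0 (fun a : Fin (B + 1) => h a)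
    (fun a b hab => hmonoN b (Nat.lt_succ_iff.1 b.2) a hab) Q hQ (by
      have hprod : ∏ b : Fin (B + 1), (q b).eval₂ (φ : ℝ →+* E) z ≠ 0 :=
        Finset.prod_ne_zero_iff.2 fun b _ => hq b
      refine (mul_eq_zero.1 (?_ : (∏ b : Fin (B + 1), (q b).eval₂ (φ : ℝ →+* E) z) * _ = 0)).resolve_left
        hprod
      rw [← hsum, Finset.mul_sum]
      refine Finset.sum_congr rfl fun a _ => ?_
      rw [MvPolynomial.eval₂_mul, hpq, MvPolynomial.eval₂_prod,
        ← Finset.mul_prod_erase _ _ (Finset.mem_univ a)]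
      ring)
  calc mk (ε * h 0) ≤ mk (ε * h b) :=
        (mk_mul_le_mk_mul_iff_left hε0).2 (hle b (Nat.lt_succ_iff.1 b.2) 0 (Nat.zero_le _))
    _ ≤ mk (h a) := hab
    _ ≤ mk (h B) := hle B le_rfl a (Nat.lt_succ_iff.1 a.2)

theorem hyperreal_eval₂_ofSeq {V : Type*} (z : ℕ → V → ℝ) (P : MvPolynomial V ℝ) :
    P.eval₂ (Hyperreal.coeRingHom : ℝ →+* Hyperreal) (fun v => Hyperreal.ofSeq fun k => z k v) =
      Hyperreal.ofSeq fun k => MvPolynomial.eval (z k) P := by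
  induction P using MvPolynomial.induction_on with
  | C a => simp; rfl
  | add P Q hP hQ =>
    simp only [MvPolynomial.eval₂_add, hP, hQ, map_add]
    rfl
  | mul_X P v hP =>
    simp only [MvPolynomial.eval₂_mul, MvPolynomial.eval₂_X, hP, map_mul, MvPolynomial.eval_X]
    rfl

open ArchimedeanClass Filter Topology in
/-- Curve selection: a point `σ` that is a limit of strictly positive solutions of polynomial
inequalities of degree at most `d` is the starting point of a positive polynomial curve of small
order that solves the inequalities up to any prescribed order. -/
theorem exists_polynomial_curve_of_tendsto {ι J : Type*} [Fintype ι] [Fintype J] {d : ℕ} (hd : 1 ≤ d)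
    (p : J → MvPolynomial ι ℝ) (hp : ∀ j, (p j).totalDegree ≤ d) (σ : ι → ℝ) (x : ℕ → ι → ℝ)
    (hx : ∀ k i, 0 < x k i) (hlim : Tendsto x atTop (𝓝 σ))
    (hpx : ∀ k j, 0 ≤ MvPolynomial.eval (x k) (p j)) {B K : ℕ}
    (hB : (2 * d + 2) ^ (2 * Fintype.card ι + Fintype.card J + 2) ≤ B) (hBK : B ≤ K) :
    ∃ X : ι → Polynomial ℝ, (∀ i, (X i).natDegree ≤ K ∧ (X i).coeff 0 = σ i ∧
        X i ≠ 0 ∧ (X i).natTrailingDegree ≤ B ∧ 0 < (X i).trailingCoeff) ∧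
      ∀ j, MvPolynomial.aeval X (p j) = 0 ∨ 0 < (MvPolynomial.aeval X (p j)).trailingCoeff ∨
          K + 1 ≤ (MvPolynomial.aeval X (p j)).natTrailingDegree := by
  classical
  let q : ι ⊕ J → MvPolynomial (Option ι) ℝ := Sum.elim (fun i => .X (some i) - .X none)
    fun j => MvPolynomial.rename some (p j)
  have hq : ∀ j, (q j).totalDegree ≤ d := by
    rintro (i | j)
    · refine (MvPolynomial.totalDegree_sub _ _).trans (max_le ?_ ?_) <;>
      · rw [MvPolynomial.totalDegree_X]
        exact hd
    · exact (MvPolynomial.totalDegree_rename_le _ _).trans (hp j)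
  obtain ⟨C, hCrel, hCsel⟩ := exists_algebraic_selection hd q hq σ
  have hdist : Tendsto (fun k => ∑ i, (x k i - σ i) ^ 2) atTop (𝓝 0) := by
    have h : Continuous fun y : ι → ℝ => ∑ i, (y i - σ i) ^ 2 := by fun_prop
    simpa [Function.comp_def] using (h.tendsto σ).comp hlim
  obtain ⟨k₀, hk₀⟩ := eventually_atTop.1 (hdist.eventually (gt_mem_nhds one_pos))
  have hmin : ∀ k : ℕ, ∃ e : ℝ, 0 < e ∧ e ≤ 1 / ((k : ℝ) + 1) ∧ ∀ i, e ≤ x k i := by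
    intro k
    have h1 : ∀ᶠ e in 𝓝[>] (0 : ℝ), e ≤ 1 / ((k : ℝ) + 1) ∧ ∀ i, e ≤ x k i := by
      refine Filter.Eventually.and ?_ (eventually_all.2 fun i => ?_)
      · exact nhdsWithin_le_nhds (Iic_mem_nhds (by positivity))
      · exact nhdsWithin_le_nhds (Iic_mem_nhds (hx k i))
    obtain ⟨e, he, he0⟩ := (h1.and self_mem_nhdsWithin).exists
    exact ⟨e, he0, he⟩
  choose e he0 hek hex using hmin
  have hsel : ∀ k : ℕ, ∃ z ∈ C, z none = e (k + k₀) ∧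
      ∑ i, (z (some i) - σ i) ^ 2 ≤ ∑ i, (x (k + k₀) i - σ i) ^ 2 ∧
      ∀ j, 0 ≤ MvPolynomial.eval z (q j) := by
    intro k
    refine hCsel (Option.elim · (e (k + k₀)) (x (k + k₀))) ?_ (hk₀ _ (Nat.le_add_left _ _))
    rintro (i | j)
    · simpa [q] using hex (k + k₀) i
    · simpa [q, MvPolynomial.eval_rename, Function.comp_def] using hpx (k + k₀) j
  choose z hzC hz0 hzσ hzq using hsel
  have hztend : ∀ i, Tendsto (fun k => z k (some i)) atTop (𝓝 (σ i)) := by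
    intro i
    have h1 : Tendsto (fun k => (z k (some i) - σ i) ^ 2) atTop (𝓝 0) := by
      refine squeeze_zero (fun _ => sq_nonneg _) (fun k => ?_)
        (hdist.comp (tendsto_add_atTop_nat k₀))
      exact (Finset.single_le_sum (f := fun i => (z k (some i) - σ i) ^ 2)
        (fun _ _ => sq_nonneg _) (Finset.mem_univ i)).trans (hzσ k)
    have h2 : Tendsto (fun k => z k (some i) - σ i) atTop (𝓝 0) := by
      rw [tendsto_zero_iff_abs_tendsto_zero]
      simpa [Real.sqrt_sq_eq_abs, Function.comp_def] using h1.sqrt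
    simpa using h2.add_const (σ i)
  have hetend : Tendsto (fun k => z k none) atTop (𝓝 0) := by
    simp_rw [hz0]
    exact (squeeze_zero (fun k => (he0 k).le) hek tendsto_one_div_add_atTop_nhds_zero_nat).comp
      (tendsto_add_atTop_nat k₀)
  have hgerm : ∀ {f : ℕ → ℝ} {c : ℝ}, Tendsto f atTop (𝓝 c) →
      (Hyperreal.ofSeq f).Tendsto (𝓝 c) := fun h =>
    Hyperreal.tendsto_ofSeq.2 (h.mono_left Nat.hyperfilter_le_atTop)
  let φ := Hyperreal.coeRingHom
  let Z : Option ι → Hyperreal := fun o => Hyperreal.ofSeq fun k => z k o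
  have hZ : ∀ P : MvPolynomial (Option ι) ℝ, P.eval₂ (φ : ℝ →+* Hyperreal) Z =
      Hyperreal.ofSeq fun k => MvPolynomial.eval (z k) P := hyperreal_eval₂_ofSeq z
  have hε0 : 0 < Z none := Hyperreal.ofSeq_lt_ofSeq.2
    (Eventually.of_forall fun k => (he0 _).trans_eq (hz0 k).symm)
  have hε : 0 < mk (Z none) := Hyperreal.archimedeanClassMk_pos_of_tendsto (hgerm hetend)
  have hmem : ∀ P : MvPolynomial (Option ι) ℝ, P.eval₂ (φ : ℝ →+* Hyperreal) Z ∈ Subfield.closure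
      (Set.range fun P : MvPolynomial (Option ι) ℝ => P.eval₂ (φ : ℝ →+* Hyperreal) Z) :=
    fun P => Subfield.subset_closure ⟨P, rfl⟩
  have hrel : ∀ g : Fin (B + 1) → MvPolynomial (Option ι) ℝ,
      ∃ Q : Fin (B + 1) → Polynomial ℝ, Q ≠ 0 ∧
        ∑ a, (g a).eval₂ (φ : ℝ →+* Hyperreal) Z * (Q a).eval₂ (φ : ℝ →+* Hyperreal) (Z none) = 0 := by
    intro g
    obtain ⟨Q, hQ, h⟩ := hCrel (B + 1) g (by
      rw [Fintype.card_sum, ← add_assoc, ← two_mul]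
      exact Nat.lt_succ_of_le hB)
    refine ⟨Q, hQ, ?_⟩
    have h1 := hZ (∑ a, g a * Polynomial.aeval (MvPolynomial.X none) (Q a))
    have h2 : ∀ k, MvPolynomial.eval (z k)
        (∑ a, g a * Polynomial.aeval (MvPolynomial.X none) (Q a)) = 0 := by
      intro k
      rw [← h _ (hzC k), map_sum]
      refine Finset.sum_congr rfl fun a _ => ?_
      rw [map_mul, Polynomial.aeval_def, Polynomial.hom_eval₂, MvPolynomial.eval_X,
        Polynomial.eval, MvPolynomial.algebraMap_eq,
        show (MvPolynomial.eval (z k)).comp MvPolynomial.C = RingHom.id ℝ from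
          RingHom.ext fun _ => MvPolynomial.eval_C _]
    simp_rw [h2] at h1
    rw [MvPolynomial.eval₂_sum] at h1
    refine Eq.trans (Finset.sum_congr rfl fun a _ => ?_) h1
    rw [MvPolynomial.eval₂_mul, ← MvPolynomial.coe_eval₂Hom _ _ , Polynomial.aeval_def,
      Polynomial.hom_eval₂, MvPolynomial.eval₂Hom_X', MvPolynomial.algebraMap_eq,
      MvPolynomial.eval₂Hom_comp_C]
  obtain ⟨X, hX, hXP⟩ := exists_polynomial_curve (φ := φ) (ε := Z none) (B := B) (K := K)
    (fun c => by simpa using hmem (MvPolynomial.C c)) hε hε0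
    (by simpa using hmem (MvPolynomial.X none))
    (fun h hF hlt => chain_bound_of_relations φ Z hε hε0.ne' hrel h hF hlt)
    (fun i => Z (some i)) (fun i => by simpa using hmem (MvPolynomial.X (some i)))
    (fun i => Hyperreal.archimedeanClassMk_nonneg_of_tendsto (hgerm (hztend i)))
    (fun i => Hyperreal.ofSeq_le_ofSeq.2 (Eventually.of_forall fun k => by
      simpa [q] using hzq k (.inl i))) hBK
  refine ⟨X, fun i => ?_, fun j => hXP (p j) ?_⟩
  · rw [← Hyperreal.stdPart_of_tendsto (hgerm (hztend i))]
    exact hX i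
  · rw [hyperreal_eval₂_ofSeq]
    refine Hyperreal.ofSeq_le_ofSeq.2 (Eventually.of_forall fun k => ?_)
    simpa [q, MvPolynomial.eval_rename, Function.comp_def] using hzq k (.inr j)

/-- The payoff difference between a strategy `τ` and a strategy `τ'` of player `n`, as a polynomial
in the strategies of the other players. -/
noncomputable def payoffDiffPoly {S : Fin N → Type} [∀ n, Fintype (S n)]
    (G : Fin N → (∀ m, S m) → ℝ) (n : Fin N) (τ τ' : S n → ℝ) : MvPolynomial (Σ n, S n) ℝ :=
  ∑ s : ∀ m, S m, .C ((τ (s n) - τ' (s n)) * G n s) *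
    ∏ m ∈ Finset.univ.erase n, .X (⟨m, s m⟩ : Σ n, S n)

theorem totalDegree_payoffDiffPoly_le {S : Fin N → Type} [∀ n, Fintype (S n)]
    (G : Fin N → (∀ m, S m) → ℝ) (n : Fin N) (τ τ' : S n → ℝ) :
    (payoffDiffPoly G n τ τ').totalDegree ≤ N - 1 := by
  refine MvPolynomial.totalDegree_finsetSum_le fun s _ => ?_
  refine (MvPolynomial.totalDegree_mul _ _).trans ?_
  rw [MvPolynomial.totalDegree_C, zero_add]
  refine (MvPolynomial.totalDegree_finsetProd _ _).trans ?_
  simp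

theorem aeval_payoffDiffPoly {S : Fin N → Type} [∀ n, Fintype (S n)]
    (G : Fin N → (∀ m, S m) → ℝ) (n : Fin N) (τ τ' : S n → ℝ) (X : (Σ n, S n) → Polynomial ℝ) :
    MvPolynomial.aeval X (payoffDiffPoly G n τ τ') =
      payoffPoly G (fun m s => X ⟨m, s⟩) n τ - payoffPoly G (fun m s => X ⟨m, s⟩) n τ' := by
  rw [payoffDiffPoly, payoffPoly, payoffPoly, ← Finset.sum_sub_distrib, map_sum]
  refine Finset.sum_congr rfl fun s _ => ?_
  simp only [map_mul, map_prod, map_sub, MvPolynomial.aeval_C, MvPolynomial.aeval_X,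
    Polynomial.algebraMap_eq]
  ring

theorem eval_payoffDiffPoly {S : Fin N → Type} [∀ n, Fintype (S n)]
    (G : Fin N → (∀ m, S m) → ℝ) (n : Fin N) (τ τ' : S n → ℝ) (ρ : Profile S) :
    MvPolynomial.eval (fun i : Σ n, S n => ρ i.1 i.2) (payoffDiffPoly G n τ τ') =
      payoff G n (Function.update ρ n τ) - payoff G n (Function.update ρ n τ') := by
  have hprod : ∀ (s : ∀ m, S m) (τ : S n → ℝ), ∏ m, Function.update ρ n τ m (s m) =
      τ (s n) * ∏ m ∈ Finset.univ.erase n, ρ m (s m) := by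
    intro s τ
    rw [← Finset.mul_prod_erase _ _ (Finset.mem_univ n), Function.update_self]
    congr 1
    refine Finset.prod_congr rfl fun m hm => ?_
    rw [Function.update_of_ne (Finset.ne_of_mem_erase hm)]
  rw [payoffDiffPoly, payoff, payoff, ← Finset.sum_sub_distrib, map_sum]
  refine Finset.sum_congr rfl fun s _ => ?_
  rw [hprod, hprod]
  simp only [map_mul, map_prod, MvPolynomial.eval_C, MvPolynomial.eval_X]
  ring

theorem pow_le_order_bound {κ d Z D : ℕ} (hκ : 2 ≤ κ) (hd : 1 ≤ d)
    (hZ : Z = (2 * d + 6) * (2 * d + 5) ^ (κ - 1)) (hD : D = 5 * (κ * (2 * d + 4) + 2) * Z) :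
    (2 * d + 2) ^ (3 * κ + 2) ≤ 2 * d * (Z * D) ^ 2 * (1 + Z) := by
  have hZ1 : (2 * d + 5) ^ κ ≤ Z := by
    obtain ⟨m, rfl⟩ : ∃ m, κ = m + 1 := ⟨κ - 1, by omega⟩
    rw [hZ, pow_succ', Nat.add_sub_cancel]
    gcongr
    omega
  have hDZ : Z ≤ D := by
    rw [hD]
    exact Nat.le_mul_of_pos_left _ (by positivity)
  calc (2 * d + 2) ^ (3 * κ + 2) ≤ (2 * d + 5) ^ (κ * 5) := by
        refine (Nat.pow_le_pow_left (by omega) _).trans (Nat.pow_le_pow_right (by omega) (by omega))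
    _ = ((2 * d + 5) ^ κ) ^ 5 := pow_mul _ _ _
    _ ≤ Z ^ 5 := Nat.pow_le_pow_left hZ1 5
    _ = 1 * (Z * Z) ^ 2 * Z := by ring
    _ ≤ 2 * d * (Z * D) ^ 2 * (1 + Z) := by
        gcongr
        · omega
        · omega

/-- a perfect equilibrium admits a polynomial strategy-profile of degree ≤ K
satisfying 2(a)-2(c). -/
theorem stmt9 {N : ℕ} (hN : 2 ≤ N) (S : Fin N → Type) [∀ n, Fintype (S n)]
    [∀ n, DecidableEq (S n)] [∀ n, Nonempty (S n)]
    (G : Fin N → (∀ m, S m) → ℝ)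
    (κ d Z D L : ℕ)
    (hκ : κ = ∑ n, Fintype.card (S n)) (hd : d = N - 1)
    (hZ : Z = (2*d+6)*(2*d+5)^(κ-1)) (hD : D = 5*(κ*(2*d+4)+2)*Z)
    (hL : L = d*(6*d-3)^(2*κ-1))
    (ℓ K : ℕ) (hℓ : ℓ = 2*d*(Z*D)^2*(1+Z)) (hK : K = L*ℓ)
    (σ : Profile S) (hσ : IsMixed σ) (hperf : IsPerfect G σ) :
    ∃ η : PolyProfile S,
      (∀ n (sn : S n), (η n sn).natDegree ≤ K) ∧
      (∀ n (sn : S n), polyPos (η n sn)) ∧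
      polyOrder η ≤ (ℓ : ℕ∞) ∧
      (∀ n (sn : S n), (η n sn).eval 0 = σ n sn) ∧
      (∀ n, polyBestReply G η n (σ n) K) := by
  obtain ⟨σk, hσk, hlim, hpay⟩ := hperf
  have hd1 : 1 ≤ d := by omega
  have hκ2 : 2 ≤ κ := by
    have h := Finset.card_nsmul_le_sum Finset.univ (fun n => Fintype.card (S n)) 1
      fun n _ => Fintype.card_pos
    simp only [Finset.card_univ, Fintype.card_fin, smul_eq_mul, mul_one] at h
    omega
  have hcard : Fintype.card (Σ n, S n) = κ := by rw [Fintype.card_sigma, hκ]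
  have hℓK : ℓ ≤ K := by
    rw [hK, hL]
    exact Nat.le_mul_of_pos_left _ (Nat.mul_pos hd1 (Nat.pow_pos (by omega)))
  obtain ⟨X, hX, hXp⟩ := exists_polynomial_curve_of_tendsto hd1
    (fun j : Σ n, S n => payoffDiffPoly G j.1 (σ j.1) (pureStrat j.2))
    (fun j => (totalDegree_payoffDiffPoly_le G _ _ _).trans_eq hd.symm)
    (fun i => σ i.1 i.2) (fun k i => σk k i.1 i.2) (fun k i => (hσk k).2 i.1 i.2)
    (tendsto_pi_nhds.2 fun i => tendsto_pi_nhds.1 (tendsto_pi_nhds.1 hlim i.1) i.2)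
    (fun k j => by
      rw [eval_payoffDiffPoly, sub_nonneg]
      exact hpay k j.1 j.2)
    (B := ℓ) (K := K) (by
      rw [hcard, hℓ, show 2 * κ + κ + 2 = 3 * κ + 2 by ring]
      exact pow_le_order_bound hκ2 hd1 hZ hD) hℓK
  refine ⟨fun n s => X ⟨n, s⟩, fun n s => (hX _).1, fun n s => (hX ⟨n, s⟩).2.2.2.2,
    Finset.sup_le fun i _ => ?_, fun n s => ?_, fun n s => ?_⟩
  · rw [Polynomial.trailingDegree_eq_natTrailingDegree (hX i).2.2.1]
    exact Nat.cast_le.2 (hX i).2.2.2.1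
  · rw [← Polynomial.coeff_zero_eq_eval_zero]
    exact (hX ⟨n, s⟩).2.1
  · have h := hXp ⟨n, s⟩
    simp only [aeval_payoffDiffPoly] at h
    rcases h with h | h | h
    · exact Or.inl (Or.inl h)
    · exact Or.inl (Or.inr h)
    · right
      rw [Polynomial.trailingDegree_eq_natTrailingDegree]
      · exact Nat.cast_le.2 h
      · intro h0
        simp [h0] at h

end GamePE
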